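/- arXiv:2406.12461 — 2 statements merged into one kernel-verified Lean document; each statement's English description precedes it below -/
import Mathlib

section
/- Let d ≥ 1, L > 0, μ ≥ 0, and let 𝑣 = (v_1,…,v_N) be a volume vector with ∑_i v_i = L^d. Define F_* := inf_G inf_D inf{ μ·Per_K(D) + (1/2)·∑_{i=1}^N Per_K(E_i) : E_i ⊆ D Borel, |E_i| = v_i, |E_i ∩ E_j| = 0 for i ≠ j, |D ∖ ⋃_i E_i| = 0 }, where the infima run over all lattices G in ℝ^d with d(G) = L^d, all fundamental domains D for G, and all admissible partitions, and Per_K is the nonlocal perimeter. Then there exist a lattice G with d(G) = L^d, a fundamental domain D for G, and a partition (E_1,…,E_N) of D with |E_i| = v_i such that F_* = μ·Per_K(D) + (1/2)·∑_i Per_K(E_i). -/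
open MeasureTheory Filter Topology
open scoped symmDiff ENNReal

noncomputable section

variable {d : ℕ}

abbrev Vd (d : ℕ) := EuclideanSpace ℝ (Fin d)

def nlPer (K : Vd d → ℝ≥0∞) (E : Set (Vd d)) : ℝ≥0∞ :=
  ∫⁻ x in E, ∫⁻ y in Eᶜ, K (x - y)

def nlPerRel (K : Vd d → ℝ≥0∞) (E Ω : Set (Vd d)) : ℝ≥0∞ :=
  (∫⁻ x in E ∩ Ω, ∫⁻ y in Eᶜ, K (x - y)) + (∫⁻ x in E \ Ω, ∫⁻ y in Ω \ E, K (x - y))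

def IsKernelBase (K : Vd d → ℝ≥0∞) : Prop :=
  Measurable K ∧ (∀ x, K (-x) = K x) ∧ (∫⁻ x, ENNReal.ofReal (min 1 ‖x‖) * K x) < ⊤

def IsKernel (s C : ℝ) (K : Vd d → ℝ≥0∞) : Prop :=
  IsKernelBase K ∧ ∀ x : Vd d, x ≠ 0 → ENNReal.ofReal (C * ‖x‖ ^ (-(d : ℝ) - s)) ≤ K x

def latticeOf (b : Fin d → Vd d) : Set (Vd d) :=
  {x | ∃ k : Fin d → ℤ, x = ∑ i, (k i : ℝ) • b i}

def IsLattice (G : Set (Vd d)) : Prop :=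
  ∃ b : Fin d → Vd d, LinearIndependent ℝ b ∧ G = latticeOf b

def IsLatticeWithVol (G : Set (Vd d)) (vol : ℝ) : Prop :=
  ∃ b : Fin d → Vd d, LinearIndependent ℝ b ∧ G = latticeOf b ∧
    |Matrix.det (Matrix.of fun i j => b j i)| = vol

def setTranslate (g : Vd d) (A : Set (Vd d)) : Set (Vd d) := (fun x => x + g) '' A

def IsFundDom (G : Set (Vd d)) (D : Set (Vd d)) : Prop :=
  MeasurableSet D ∧ (∀ g ∈ G, g ≠ 0 → volume (setTranslate g D ∩ D) = 0) ∧
    volume (Set.univ \ ⋃ g ∈ G, setTranslate g D) = 0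

def packingRadius (G : Set (Vd d)) : ℝ :=
  sSup {r : ℝ | 0 < r ∧ ∀ g₁ ∈ G, ∀ g₂ ∈ G, g₁ ≠ g₂ →
    Disjoint (Metric.ball g₁ r) (Metric.ball g₂ r)}

def phiK (K : Vd d → ℝ≥0∞) (t : ℝ) : ℝ≥0∞ := ∫⁻ x in (Metric.ball (0 : Vd d) t)ᶜ, K x

def setDist (A B : Set (Vd d)) : ℝ := sInf ((fun p : Vd d × Vd d => dist p.1 p.2) '' (A ×ˢ B))

def TendstoL1loc (E : ℕ → Set (Vd d)) (F : Set (Vd d)) : Prop :=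
  ∀ R : ℝ, 0 < R → Tendsto (fun n => volume ((E n ∆ F) ∩ Metric.ball 0 R)) atTop (𝓝 0)

def AdmissiblePart (D : Set (Vd d)) {N : ℕ} (v : Fin N → ℝ) (E : Fin N → Set (Vd d)) : Prop :=
  (∀ i, MeasurableSet (E i)) ∧ (∀ i, E i ⊆ D) ∧
  (∀ i, volume (E i) = ENNReal.ofReal (v i)) ∧
  (∀ i j, i ≠ j → volume (E i ∩ E j) = 0) ∧
  volume (D \ ⋃ i, E i) = 0

def AdmissiblePart₀ (D : Set (Vd d)) {N : ℕ} (E : Fin N → Set (Vd d)) : Prop :=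
  (∀ i, MeasurableSet (E i)) ∧ (∀ i, E i ⊆ D) ∧
  (∀ i j, i ≠ j → volume (E i ∩ E j) = 0) ∧
  volume (D \ ⋃ i, E i) = 0

def ediff (a b : ℝ≥0∞) : ℝ≥0∞ := (a - b) + (b - a)

def IsPartition {J : Type*} (A : J → Set (Vd d)) : Prop :=
  (∀ j, MeasurableSet (A j)) ∧ (∀ j j', j ≠ j' → volume (A j ∩ A j') = 0) ∧
  volume (Set.univ \ ⋃ j, A j) = 0

def ComptContained (S Ω : Set (Vd d)) : Prop := IsCompact (closure S) ∧ closure S ⊆ Ω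

def IsVolConstrMin (K : Vd d → ℝ≥0∞) (Λ : ℝ≥0∞) (Ω : Set (Vd d))
    {J : Type*} (A : J → Set (Vd d)) : Prop :=
  (∑' j, nlPerRel K (A j) Ω) ≠ ⊤ ∧
  ∀ B : J → Set (Vd d), IsPartition B →
    (∀ j, ComptContained (A j ∆ B j) Ω) →
    (∀ j, volume (A j ∩ Ω) = volume (B j ∩ Ω)) →
    (∑' j, nlPerRel K (A j) Ω) ≤ ∑' j, (nlPerRel K (B j) Ω + Λ * volume (A j ∆ B j))

def IsLamMin (K : Vd d → ℝ≥0∞) (Λ : ℝ≥0∞) (Ω : Set (Vd d))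
    {J : Type*} (A : J → Set (Vd d)) : Prop :=
  (∑' j, nlPerRel K (A j) Ω) ≠ ⊤ ∧
  ∀ B : J → Set (Vd d), IsPartition B →
    (∀ j, ComptContained (A j ∆ B j) Ω) →
    (∑' j, nlPerRel K (A j) Ω) ≤ ∑' j, (nlPerRel K (B j) Ω + Λ * volume (A j ∆ B j))

/-- The set `A - h`. -/
def shift (h : Vd d) (A : Set (Vd d)) : Set (Vd d) := (fun x => x + h) ⁻¹' A

/-- The measure on the product space with density `k (x - y)`. -/
def pairMeasure (k : Vd d → ℝ≥0∞) : Measure (Vd d × Vd d) :=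
  (volume.prod volume).withDensity fun p => k (p.1 - p.2)

@[simp] lemma mem_shift {h x : Vd d} {A : Set (Vd d)} : x ∈ shift h A ↔ x + h ∈ A := Iff.rfl

lemma setTranslate_eq_shift (g : Vd d) (A : Set (Vd d)) : setTranslate g A = shift (-g) A := by
  ext x
  simp [setTranslate, ← sub_eq_add_neg]

lemma measurableSet_shift (h : Vd d) {A : Set (Vd d)} (hA : MeasurableSet A) :
    MeasurableSet (shift h A) :=
  (measurable_add_const h) hA

lemma volume_shift (h : Vd d) (A : Set (Vd d)) : volume (shift h A) = volume A :=
  measure_preimage_add_right volume h A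

lemma shift_shift (g h : Vd d) (A : Set (Vd d)) : shift g (shift h A) = shift (g + h) A := by
  ext x; simp [add_assoc]

lemma shift_ball (h x : Vd d) (r : ℝ) : shift h (Metric.ball x r) = Metric.ball (x - h) r := by
  ext y
  simp only [mem_shift, Metric.mem_ball, dist_eq_norm]
  rw [show y + h - x = y - (x - h) by abel]

lemma pairMeasure_apply {k : Vd d → ℝ≥0∞} (hk : Measurable k) {A B : Set (Vd d)}
    (hA : MeasurableSet A) (hB : MeasurableSet B) :
    pairMeasure k (A ×ˢ B) = ∫⁻ x in A, ∫⁻ y in B, k (x - y) := by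
  have hk' : Measurable fun p : Vd d × Vd d => k (p.1 - p.2) := by fun_prop
  rw [pairMeasure, withDensity_apply _ (hA.prod hB), ← Measure.prod_restrict,
    lintegral_prod _ hk'.aemeasurable]

lemma nlPer_eq {K : Vd d → ℝ≥0∞} (hK : Measurable K) {A : Set (Vd d)} (hA : MeasurableSet A) :
    nlPer K A = pairMeasure K (A ×ˢ Aᶜ) := by
  rw [pairMeasure_apply hK hA hA.compl, nlPer]

lemma pairMeasure_shift {k : Vd d → ℝ≥0∞} (hk : Measurable k) (h : Vd d) {A B : Set (Vd d)}
    (hA : MeasurableSet A) (hB : MeasurableSet B) :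
    pairMeasure k (shift h A ×ˢ shift h B) = pairMeasure k (A ×ˢ B) := by
  rw [pairMeasure_apply hk hA hB,
    pairMeasure_apply hk (measurableSet_shift h hA) (measurableSet_shift h hB)]
  have e := measurePreserving_add_right (volume : Measure (Vd d)) h
  rw [shift, shift, ← e.setLIntegral_comp_preimage hA (by fun_prop)]
  refine lintegral_congr fun x => ?_
  rw [← e.setLIntegral_comp_preimage hB (by fun_prop)]
  simp

lemma nlPer_shift {K : Vd d → ℝ≥0∞} (hK : Measurable K) (h : Vd d) {A : Set (Vd d)}
    (hA : MeasurableSet A) : nlPer K (shift h A) = nlPer K A := by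
  rw [nlPer_eq hK hA, nlPer_eq hK (measurableSet_shift h hA), ← pairMeasure_shift hK h hA hA.compl]
  rfl

lemma nlPer_compl {K : Vd d → ℝ≥0∞} (hK : Measurable K) (hKs : ∀ x, K (-x) = K x)
    (A : Set (Vd d)) : nlPer K Aᶜ = nlPer K A := by
  unfold nlPer
  rw [compl_compl, lintegral_lintegral_swap (f := fun x y => K (x - y))
    (hK.comp (measurable_fst.sub measurable_snd)).aemeasurable]
  refine lintegral_congr fun x => lintegral_congr fun y => ?_
  rw [← hKs, neg_sub]

lemma nlPer_union_le {K : Vd d → ℝ≥0∞} (hK : Measurable K) {ι : Type*} [Countable ι]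
    {A : ι → Set (Vd d)} (hA : ∀ i, MeasurableSet (A i)) :
    nlPer K (⋃ i, A i) ≤ ∑' i, nlPer K (A i) := by
  simp_rw [nlPer_eq hK (hA _), nlPer_eq hK (MeasurableSet.iUnion hA)]
  refine (measure_mono ?_).trans (measure_iUnion_le _)
  rintro ⟨x, y⟩ ⟨hx, hy⟩
  obtain ⟨i, hi⟩ := Set.mem_iUnion.1 hx
  exact Set.mem_iUnion.2 ⟨i, hi, fun h => hy (Set.mem_iUnion.2 ⟨i, h⟩)⟩

lemma nlPer_congr_ae {K : Vd d → ℝ≥0∞} {A B : Set (Vd d)} (h : A =ᵐ[volume] B) :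
    nlPer K A = nlPer K B := by
  unfold nlPer
  rw [Measure.restrict_congr_set h, Measure.restrict_congr_set h.compl]

/-- Sets of perimeter at most `P` are, outside a set of measure `ε`, recognised at a small scale
by the majority in any ball around a nearby point. -/
lemma exists_majority {s C : ℝ} {K : Vd d → ℝ≥0∞} (hd : 1 ≤ d) (hs : 0 < s) (hC : 0 < C)
    (hK : IsKernel s C K) {P : ℝ≥0∞} (hP : P ≠ ⊤) {ε : ℝ≥0∞} (hε : ε ≠ 0) :
    ∃ ρ : ℝ, 0 < ρ ∧ ρ ≤ 1 ∧ ∀ A : Set (Vd d), MeasurableSet A → nlPer K A ≤ P →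
      ∃ W : Set (Vd d), volume W ≤ ε ∧ ∀ x ∉ W, ∀ z, dist x z < ρ →
        (x ∈ A ↔ volume (Metric.ball (0 : Vd d) ρ) / 2 < volume (A ∩ Metric.ball z ρ)) := by
  have : Nonempty (Fin d) := ⟨⟨0, hd⟩⟩
  obtain ⟨⟨hKm, hKs, -⟩, hKl⟩ := hK
  set ω : ℝ≥0∞ := volume (Metric.ball (0 : Vd d) 1) with hω
  have hω0 : ω ≠ 0 := (Metric.measure_ball_pos volume _ one_pos).ne'
  have hωt : ω ≠ ⊤ := measure_ball_lt_top.ne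
  -- choice of the scale
  have hlim : Tendsto (fun ρ : ℝ => C * 2 ^ (-(d : ℝ) - s) * ρ ^ (-s)) (𝓝[>] 0) atTop :=
    (tendsto_rpow_neg_nhdsGT_zero (neg_neg_of_pos hs)).const_mul_atTop (by positivity)
  have hlim2 : Tendsto (fun ρ : ℝ => ENNReal.ofReal (C * 2 ^ (-(d : ℝ) - s) * ρ ^ (-s)))
      (𝓝[>] 0) (𝓝 ⊤) := ENNReal.tendsto_ofReal_atTop.comp hlim
  obtain ⟨ρ, hρ2, hρ0, hρ1⟩ : ∃ ρ : ℝ, 2 * P / ε / (ω / 2) <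
      ENNReal.ofReal (C * 2 ^ (-(d : ℝ) - s) * ρ ^ (-s)) ∧ 0 < ρ ∧ ρ ≤ 1 := by
    have h1 : ∀ᶠ ρ : ℝ in 𝓝[>] 0, 2 * P / ε / (ω / 2) <
        ENNReal.ofReal (C * 2 ^ (-(d : ℝ) - s) * ρ ^ (-s)) := by
      refine hlim2.eventually (lt_mem_nhds ?_)
      refine ENNReal.div_lt_top (ENNReal.div_ne_top (by finiteness) hε) ?_
      simp [hω0]
    have h2 : ∀ᶠ ρ : ℝ in 𝓝[>] 0, ρ ∈ Set.Ioc (0 : ℝ) 1 := Ioc_mem_nhdsGT one_pos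
    obtain ⟨ρ, h⟩ := (h1.and h2).exists
    exact ⟨ρ, h.1, h.2⟩
  set β : ℝ≥0∞ := volume (Metric.ball (0 : Vd d) ρ) / 2 with hβ
  set κ : ℝ≥0∞ := ENNReal.ofReal (C * (2 * ρ) ^ (-(d : ℝ) - s)) with hκ
  have hvol : ∀ z : Vd d, volume (Metric.ball z ρ) = ENNReal.ofReal (ρ ^ d) * ω := by
    intro z
    rw [Measure.addHaar_ball _ _ hρ0.le]; simp [hω]
  have hβt : β ≠ ⊤ := by
    rw [hβ]; exact ENNReal.div_ne_top measure_ball_lt_top.ne (by simp)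
  have hlam : 2 * P / ε < κ * β := by
    have : κ * β = ENNReal.ofReal (C * 2 ^ (-(d : ℝ) - s) * ρ ^ (-s)) * (ω / 2) := by
      rw [hβ, hvol, hκ, mul_div_assoc, ← mul_assoc, ← ENNReal.ofReal_mul (by positivity)]
      congr 2
      rw [Real.mul_rpow (by norm_num) hρ0.le, ← Real.rpow_natCast ρ d]
      have : ρ ^ (-s) = ρ ^ (-(d : ℝ) - s) * ρ ^ (d : ℝ) := by
        rw [← Real.rpow_add hρ0]; congr 1; ring
      rw [this]; ring
    rw [this]
    exact (ENNReal.div_lt_iff (Or.inl (by simp [hω0]))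
      (Or.inl (ENNReal.div_ne_top hωt (by simp)))).1 hρ2
  refine ⟨ρ, hρ0, hρ1, fun A hA hPA => ?_⟩
  -- the key pointwise lower bound
  have key : ∀ (B : Set (Vd d)), MeasurableSet B → ∀ x z : Vd d, dist x z < ρ →
      β ≤ volume (B ∩ Metric.ball z ρ) → κ * β ≤ ∫⁻ y in B, K (x - y) := by
    intro B hB x z hxz hb
    calc κ * β ≤ κ * volume (B ∩ Metric.ball z ρ) := by gcongr
      _ = ∫⁻ y in B ∩ Metric.ball z ρ, κ := by simp
      _ ≤ ∫⁻ y in B ∩ Metric.ball z ρ, K (x - y) := by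
        refine setLIntegral_mono_ae (by fun_prop) ?_
        have : ∀ᵐ y : Vd d, y ≠ x := by simp [ae_iff]
        filter_upwards [this] with y hy hyB
        refine le_trans ?_ (hKl (x - y) (sub_ne_zero.2 hy.symm))
        apply ENNReal.ofReal_le_ofReal
        have hpos : 0 < ‖x - y‖ := norm_pos_iff.2 (sub_ne_zero.2 hy.symm)
        have hle : ‖x - y‖ ≤ 2 * ρ := by
          have h1 := hyB.2
          rw [Metric.mem_ball] at h1
          have := dist_triangle_right x y z
          rw [← dist_eq_norm]; linarith
        gcongr ?_ * ?_
        exact Real.rpow_le_rpow_of_nonpos hpos hle (by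
          have : (0 : ℝ) ≤ d := Nat.cast_nonneg d
          linarith)
      _ ≤ ∫⁻ y in B, K (x - y) := lintegral_mono_set Set.inter_subset_left
  have markov : ∀ (B : Set (Vd d)), MeasurableSet B → nlPer K B ≤ P →
      volume {x | x ∈ B ∧ κ * β ≤ ∫⁻ y in Bᶜ, K (x - y)} ≤ ε / 2 := by
    intro B hB hPB
    have hm : Measurable fun x : Vd d => ∫⁻ y in Bᶜ, K (x - y) :=
      Measurable.lintegral_prod_right' (f := fun p : Vd d × Vd d => K (p.1 - p.2)) (by fun_prop)
    have h1 := mul_meas_ge_le_lintegral (μ := volume.restrict B) hm (κ * β)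
    rw [Measure.restrict_apply (measurableSet_le measurable_const hm)] at h1
    have h2 : κ * β * volume {x | x ∈ B ∧ κ * β ≤ ∫⁻ y in Bᶜ, K (x - y)} ≤ P := by
      refine le_trans ?_ (h1.trans hPB)
      gcongr
      exact fun x hx => ⟨hx.2, hx.1⟩
    rcases eq_or_ne P 0 with hP0 | hP0
    · subst hP0
      have h3 : κ * β ≠ 0 := by simpa using hlam.ne_bot
      have := (mul_eq_zero.1 (le_antisymm h2 bot_le)).resolve_left h3
      rw [this]; exact bot_le
    have h3 : 2 * P / ε * volume {x | x ∈ B ∧ κ * β ≤ ∫⁻ y in Bᶜ, K (x - y)} ≤ P :=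
      le_trans (by gcongr) h2
    rcases eq_or_ne ε ⊤ with rfl | hεt
    · rw [ENNReal.top_div_of_ne_top (by simp)]; exact le_top
    have h4 : 2 * P / ε ≠ 0 := by
      simp [hP0, hεt]
    have h5 : 2 * P / ε ≠ ⊤ := ENNReal.div_ne_top (by finiteness) hε
    rw [mul_comm, ← ENNReal.le_div_iff_mul_le (Or.inl h4) (Or.inl h5)] at h3
    refine h3.trans (le_of_eq ?_)
    rw [div_eq_mul_inv, ENNReal.inv_div (Or.inl hεt) (Or.inl hε), ← mul_div_assoc, mul_comm P,
      ENNReal.mul_div_mul_right _ _ hP0 hP]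
  refine ⟨{x | x ∈ A ∧ κ * β ≤ ∫⁻ y in Aᶜ, K (x - y)} ∪
    {x | x ∈ Aᶜ ∧ κ * β ≤ ∫⁻ y in Aᶜᶜ, K (x - y)}, ?_, ?_⟩
  · refine (measure_union_le _ _).trans ?_
    refine (add_le_add (markov A hA hPA) (markov _ hA.compl ?_)).trans (ENNReal.add_halves ε).le
    rwa [nlPer_compl hKm hKs]
  · intro x hx z hxz
    simp only [Set.mem_union, Set.mem_ofPred_eq, not_or, not_and] at hx
    constructor
    · intro hxA
      by_contra! hcon
      refine hx.1 hxA (key _ hA.compl x z hxz ?_)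
      have h1 : volume (Metric.ball z ρ) ≤ volume (A ∩ Metric.ball z ρ) +
          volume (Aᶜ ∩ Metric.ball z ρ) := by
        refine (measure_mono ?_).trans (measure_union_le _ _)
        intro y hy
        by_cases h : y ∈ A
        · exact Or.inl ⟨h, hy⟩
        · exact Or.inr ⟨h, hy⟩
      have h2 : volume (Metric.ball z ρ) = β + β := by
        rw [hβ, ENNReal.add_halves, hvol, hvol]
      rw [h2] at h1
      exact (ENNReal.add_le_add_iff_left hβt).1 (h1.trans (by gcongr))
    · intro h
      by_contra hxA
      refine hx.2 hxA (key _ hA.compl.compl x z hxz ?_)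
      rw [compl_compl]
      exact h.le

/-- Local convergence in measure of a sequence of sets along a filter. -/
def TendstoLoc (F : Filter ℕ) (A : ℕ → Set (Vd d)) (B : Set (Vd d)) : Prop :=
  ∀ R : ℝ, Tendsto (fun n => volume ((A n ∆ B) ∩ Metric.ball 0 R)) F (𝓝 0)

/-- A Cauchy criterion for local convergence along an ultrafilter. -/
lemma exists_tendstoLoc_of_cauchy {U : Ultrafilter ℕ} {A : ℕ → Set (Vd d)}
    (hA : ∀ n, MeasurableSet (A n))
    (hc : ∀ k : ℕ, ∃ S ∈ U, ∀ n ∈ S, ∀ m ∈ S,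
      volume ((A n ∆ A m) ∩ Metric.ball 0 k) ≤ 2⁻¹ ^ k) :
    ∃ B : Set (Vd d), MeasurableSet B ∧ TendstoLoc U A B := by
  choose S hSU hS using hc
  have hne : ∀ k : ℕ, ∃ n, ∀ j ≤ k, n ∈ S j := by
    intro k
    have : ∀ᶠ n in (U : Filter ℕ), ∀ j ∈ Finset.range (k + 1), n ∈ S j :=
      (Filter.eventually_all_finset _).2 fun j _ => hSU j
    obtain ⟨n, hn⟩ := this.exists
    exact ⟨n, fun j hj => hn j (Finset.mem_range.2 (by omega))⟩
  choose ν hν using hne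
  set B : Set (Vd d) := ⋃ k, ⋂ l, ⋂ (_ : k ≤ l), A (ν l) with hB
  have hsub : ∀ k, A (ν k) ∆ B ⊆ ⋃ l : ℕ, A (ν (k + l)) ∆ A (ν (k + l + 1)) := by
    intro k x hx
    by_contra hcon
    simp only [Set.mem_iUnion, not_exists, Set.mem_symmDiff] at hcon
    have hiff : ∀ l, x ∈ A (ν (k + l)) ↔ x ∈ A (ν k) := by
      intro l
      induction l with
      | zero => rfl
      | succ l ih => have := hcon l; rw [← ih, ← add_assoc]; tauto
    have hxB : x ∈ B ↔ x ∈ A (ν k) := by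
      simp only [hB, Set.mem_iUnion, Set.mem_iInter]
      constructor
      · rintro ⟨m, hm⟩
        exact (hiff m).1 (hm (k + m) (by omega))
      · intro hx
        refine ⟨k, fun l hl => ?_⟩
        obtain ⟨i, rfl⟩ := Nat.exists_eq_add_of_le hl
        exact (hiff i).2 hx
    rw [Set.mem_symmDiff] at hx
    tauto
  have htail : ∀ k : ℕ, volume ((A (ν k) ∆ B) ∩ Metric.ball 0 k) ≤ 2 * 2⁻¹ ^ k := by
    intro k
    calc volume ((A (ν k) ∆ B) ∩ Metric.ball 0 k)
        ≤ volume (⋃ l : ℕ, (A (ν (k + l)) ∆ A (ν (k + l + 1))) ∩ Metric.ball 0 ((k + l : ℕ) : ℝ)) := by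
          refine measure_mono fun x hx => ?_
          obtain ⟨l, hl⟩ := Set.mem_iUnion.1 (hsub k hx.1)
          refine Set.mem_iUnion.2 ⟨l, hl, Metric.ball_subset_ball ?_ hx.2⟩
          push_cast; linarith [(Nat.cast_nonneg l : (0 : ℝ) ≤ l)]
      _ ≤ ∑' l : ℕ, volume ((A (ν (k + l)) ∆ A (ν (k + l + 1))) ∩
            Metric.ball 0 ((k + l : ℕ) : ℝ)) := measure_iUnion_le _
      _ ≤ ∑' l : ℕ, (2⁻¹ : ℝ≥0∞) ^ (k + l) := by
          refine ENNReal.tsum_le_tsum fun l => ?_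
          exact hS _ _ (hν _ _ le_rfl) _ (hν _ _ (by omega))
      _ = 2 * 2⁻¹ ^ k := by
          simp_rw [pow_add]
          rw [ENNReal.tsum_mul_left, ENNReal.tsum_geometric_two, mul_comm]
  refine ⟨B, MeasurableSet.iUnion fun k => MeasurableSet.iInter fun l =>
    MeasurableSet.iInter fun _ => hA _, fun R => ?_⟩
  rw [ENNReal.tendsto_nhds_zero]
  intro ε hε
  have hlim : Tendsto (fun k : ℕ => (3 : ℝ≥0∞) * 2⁻¹ ^ k) atTop (𝓝 0) := by
    have := ENNReal.Tendsto.const_mul (a := 3)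
      (ENNReal.tendsto_pow_atTop_nhds_zero_of_lt_one (r := (2⁻¹ : ℝ≥0∞)) (by simp))
      (Or.inr (by simp))
    simpa using this
  obtain ⟨k, hk, hkR⟩ := ((ENNReal.tendsto_nhds_zero.1 hlim ε hε).and
    (eventually_ge_atTop ⌈R⌉₊)).exists
  have hkR' : R ≤ k := (Nat.le_ceil R).trans (by exact_mod_cast hkR)
  filter_upwards [hSU k] with n hn
  calc volume ((A n ∆ B) ∩ Metric.ball 0 R)
      ≤ volume (((A n ∆ A (ν k)) ∩ Metric.ball 0 k) ∪ ((A (ν k) ∆ B) ∩ Metric.ball 0 k)) := by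
        refine measure_mono fun x hx => ?_
        have hxk := Metric.ball_subset_ball hkR' hx.2
        rcases symmDiff_triangle (A n) (A (ν k)) B hx.1 with h | h
        · exact Or.inl ⟨h, hxk⟩
        · exact Or.inr ⟨h, hxk⟩
    _ ≤ 2⁻¹ ^ k + 2 * 2⁻¹ ^ k := (measure_union_le _ _).trans
        (add_le_add (hS k n hn _ (hν k k le_rfl)) (htail k))
    _ = 3 * 2⁻¹ ^ k := by ring
    _ ≤ ε := hk

/-- Compactness of sets with bounded nonlocal perimeter. -/
lemma exists_tendstoLoc {s C : ℝ} {K : Vd d → ℝ≥0∞} (hd : 1 ≤ d) (hs : 0 < s) (hC : 0 < C)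
    (hK : IsKernel s C K) {P : ℝ≥0∞} (hP : P ≠ ⊤) (U : Ultrafilter ℕ) {A : ℕ → Set (Vd d)}
    (hA : ∀ n, MeasurableSet (A n)) (hPA : ∀ n, nlPer K (A n) ≤ P) :
    ∃ B : Set (Vd d), MeasurableSet B ∧ TendstoLoc U A B := by
  classical
  refine exists_tendstoLoc_of_cauchy hA fun k => ?_
  obtain ⟨ρ, hρ, -, hmaj⟩ := exists_majority hd hs hC hK hP
    (ε := 2⁻¹ ^ k / 2) (ENNReal.div_ne_zero.2 ⟨by simp, by simp⟩)
  choose W hWv hW using fun n => hmaj (A n) (hA n) (hPA n)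
  obtain ⟨Z, hZfin, hZ⟩ := Metric.totallyBounded_iff.1
    ((isCompact_closedBall (0 : Vd d) k).totallyBounded.subset Metric.ball_subset_closedBall) ρ hρ
  set color : ℕ → Z → Prop := fun n z =>
    volume (Metric.ball (0 : Vd d) ρ) / 2 < volume (A n ∩ Metric.ball (z : Vd d) ρ) with hcolor
  have : Finite Z := hZfin
  have : Finite (Z → Prop) := inferInstance
  obtain ⟨c, hc⟩ : ∃ c : Z → Prop, ∀ᶠ n in (U : Filter ℕ), color n = c := by
    obtain ⟨c, -, hc⟩ := (Ultrafilter.finite_biUnion_mem_iff (f := U)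
      (is := (Set.univ : Set (Z → Prop))) (s := fun c => {n | color n = c}) Set.finite_univ).1 (by
        rw [show (⋃ c ∈ (Set.univ : Set (Z → Prop)), {n | color n = c}) = Set.univ by ext n; simp]
        exact Filter.univ_mem)
    exact ⟨c, hc⟩
  refine ⟨{n | color n = c}, hc, fun n hn m hm => ?_⟩
  refine (measure_mono (t := W n ∪ W m) ?_).trans
    ((measure_union_le _ _).trans ((add_le_add (hWv n) (hWv m)).trans (ENNReal.add_halves _).le))
  rintro x ⟨hx, hxk⟩
  by_contra hcon
  rw [Set.mem_union, not_or] at hcon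
  obtain ⟨z, hz, hxz⟩ := Set.mem_iUnion₂.1 (hZ hxk)
  have h1 := hW n x hcon.1 z hxz
  have h2 := hW m x hcon.2 z hxz
  have h3 : color n ⟨z, hz⟩ = color m ⟨z, hz⟩ := by
    rw [show color n = c from hn, show color m = c from hm]
  simp only [hcolor] at h3
  rw [Set.mem_symmDiff] at hx
  rw [h3] at h1
  tauto

lemma TendstoLoc.of_symmDiff_subset {F : Filter ℕ} {ι : Type*} [Fintype ι]
    {A : ℕ → Set (Vd d)} {B : Set (Vd d)} {A' : ι → ℕ → Set (Vd d)} {B' : ι → Set (Vd d)}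
    {Z : ℕ → Set (Vd d)} (h : ∀ i, TendstoLoc F (A' i) (B' i)) (hZ : ∀ n, volume (Z n) = 0)
    (hsub : ∀ n, A n ∆ B ⊆ Z n ∪ ⋃ i, A' i n ∆ B' i) : TendstoLoc F A B := by
  intro R
  have h0 : Tendsto (fun n => ∑ i, volume ((A' i n ∆ B' i) ∩ Metric.ball 0 R)) F (𝓝 0) := by
    have := tendsto_finsetSum (Finset.univ : Finset ι) fun i _ => h i R
    simpa using this
  refine tendsto_of_tendsto_of_tendsto_of_le_of_le tendsto_const_nhds h0 (fun _ => bot_le)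
    fun n => ?_
  calc volume ((A n ∆ B) ∩ Metric.ball 0 R)
      ≤ volume (Z n ∪ ⋃ i, (A' i n ∆ B' i) ∩ Metric.ball 0 R) := by
        refine measure_mono fun x hx => ?_
        rcases hsub n hx.1 with h | h
        · exact Or.inl h
        · obtain ⟨i, hi⟩ := Set.mem_iUnion.1 h
          exact Or.inr (Set.mem_iUnion.2 ⟨i, hi, hx.2⟩)
    _ ≤ 0 + ∑ i, volume ((A' i n ∆ B' i) ∩ Metric.ball 0 R) :=
        (measure_union_le _ _).trans (add_le_add (hZ n).le (measure_iUnion_fintype_le _ _))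
    _ = _ := zero_add _

lemma TendstoLoc.shift {F : Filter ℕ} {A : ℕ → Set (Vd d)} {B : Set (Vd d)}
    (hB : MeasurableSet B) (h : TendstoLoc F A B) {g : ℕ → Vd d} {g₀ : Vd d}
    (hg : Tendsto g F (𝓝 g₀)) : TendstoLoc F (fun n => shift (g n) (A n)) (shift g₀ B) := by
  intro R
  set R' : ℝ := R + (‖g₀‖ + 1) with hR'
  have hgR : ∀ᶠ n in F, ‖g n‖ < ‖g₀‖ + 1 := hg.norm.eventually (gt_mem_nhds (by linarith))
  have hball : ∀ n, ‖g n‖ < ‖g₀‖ + 1 → ∀ x ∈ Metric.ball (0 : Vd d) R, x + g n ∈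
      Metric.ball (0 : Vd d) R' := by
    intro n hn x hx
    rw [mem_ball_zero_iff] at hx ⊢
    exact (norm_add_le _ _).trans_lt (by linarith)
  let f : Vd d → C(Vd d, Vd d) := fun v => ⟨fun x => x + v, by fun_prop⟩
  have hf : Continuous f := ContinuousMap.continuous_of_continuous_uncurry _ (by
    change Continuous fun p : Vd d × Vd d => p.2 + p.1
    fun_prop)
  have hpres : ∀ v, MeasurePreserving (f v) (volume : Measure (Vd d)) volume :=
    fun v => measurePreserving_add_right volume v
  have h2 := tendsto_measure_symmDiff_preimage_nhds_zero ((hf.tendsto g₀).comp hg)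
    (Eventually.of_forall fun n => hpres (g n)) (hpres g₀)
    (hB.inter (measurableSet_ball (x := (0 : Vd d)) (ε := R'))).nullMeasurableSet
    ((measure_mono Set.inter_subset_right).trans_lt measure_ball_lt_top).ne
  have h3 := (h R').add h2
  rw [add_zero] at h3
  refine tendsto_of_tendsto_of_tendsto_of_le_of_le' tendsto_const_nhds h3
    (Eventually.of_forall fun _ => bot_le) ?_
  filter_upwards [hgR] with n hn
  rw [← volume_shift (g n) ((A n ∆ B) ∩ Metric.ball 0 R')]
  refine (measure_mono ?_).trans (measure_union_le _ _)
  rintro x ⟨hx, hxR⟩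
  have hb1 := hball n hn x hxR
  have hb2 : x + g₀ ∈ Metric.ball (0 : Vd d) R' := by
    rw [mem_ball_zero_iff] at hxR ⊢
    exact (norm_add_le _ _).trans_lt (by linarith)
  have e1 : x ∈ (f (g n)) ⁻¹' (B ∩ Metric.ball 0 R') ↔ x + g n ∈ B :=
    ⟨fun h => h.1, fun h => ⟨h, hb1⟩⟩
  have e2 : x ∈ (f g₀) ⁻¹' (B ∩ Metric.ball 0 R') ↔ x + g₀ ∈ B :=
    ⟨fun h => h.1, fun h => ⟨h, hb2⟩⟩
  simp only [Function.comp_apply, Set.mem_union, mem_shift, Set.mem_inter_iff, Set.mem_symmDiff,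
    hb1, and_true, e1, e2] at hx ⊢
  tauto

lemma volume_eq_zero_of_forall_inter_ball {B : Set (Vd d)}
    (h : ∀ R : ℝ, volume (B ∩ Metric.ball 0 R) = 0) : volume B = 0 := by
  have : B = ⋃ n : ℕ, B ∩ Metric.ball 0 (n : ℝ) := by
    rw [← Set.inter_iUnion, Metric.iUnion_ball_nat, Set.inter_univ]
  rw [this, measure_iUnion_null_iff]
  exact fun n => h n

lemma TendstoLoc.volume_inter_eq_zero {F : Filter ℕ} [F.NeBot] {A A' : ℕ → Set (Vd d)}
    {B B' : Set (Vd d)} (h : TendstoLoc F A B) (h' : TendstoLoc F A' B')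
    (h0 : ∀ᶠ n in F, volume (A n ∩ A' n) = 0) : volume (B ∩ B') = 0 := by
  refine volume_eq_zero_of_forall_inter_ball fun R => ?_
  have h1 := (h R).add (h' R)
  rw [add_zero] at h1
  refine le_antisymm (ge_of_tendsto h1 ?_) bot_le
  filter_upwards [h0] with n hn
  calc volume (B ∩ B' ∩ Metric.ball 0 R)
      ≤ volume ((A n ∩ A' n) ∪ (((A n ∆ B) ∩ Metric.ball 0 R) ∪
          ((A' n ∆ B') ∩ Metric.ball 0 R))) := by
        refine measure_mono fun x hx => ?_
        simp only [Set.mem_union, Set.mem_inter_iff, Set.mem_symmDiff] at hx ⊢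
        tauto
    _ ≤ 0 + (_ + _) := (measure_union_le _ _).trans
        (add_le_add hn.le (measure_union_le _ _))
    _ = _ := zero_add _

/-- The interaction energy inside the ball of radius `M` with truncated kernel. -/
def truncPer (K : Vd d → ℝ≥0∞) (M : ℕ) (A : Set (Vd d)) : ℝ≥0∞ :=
  pairMeasure (fun x => min (K x) M) ((A ∩ Metric.ball 0 M) ×ˢ (Metric.ball 0 M \ A))

lemma tendsto_truncPer {K : Vd d → ℝ≥0∞} (hK : Measurable K) {A : Set (Vd d)}
    (hA : MeasurableSet A) :
    Tendsto (fun M => truncPer K M A) atTop (𝓝 (nlPer K A)) := by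
  have hS : ∀ M : ℕ, MeasurableSet
      ((A ∩ Metric.ball (0 : Vd d) M) ×ˢ (Metric.ball (0 : Vd d) M \ A)) := fun M =>
    (hA.inter measurableSet_ball).prod (measurableSet_ball.diff hA)
  have hf : ∀ M : ℕ, Measurable fun p : Vd d × Vd d => min (K (p.1 - p.2)) M := fun M => by fun_prop
  rw [nlPer_eq hK hA, pairMeasure, withDensity_apply _ (hA.prod hA.compl),
    ← lintegral_indicator (hA.prod hA.compl)]
  simp_rw [truncPer, pairMeasure, withDensity_apply _ (hS _), ← lintegral_indicator (hS _)]
  refine lintegral_tendsto_of_tendsto_of_monotone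
    (fun M => ((hf M).indicator (hS M)).aemeasurable) ?_ ?_
  · refine Eventually.of_forall fun p M N hMN => ?_
    have hMN' : (M : ℝ) ≤ N := by exact_mod_cast hMN
    refine Set.indicator_le_indicator_of_subset ?_ (fun _ => bot_le) p |>.trans
      (Set.indicator_le_indicator ?_)
    · rintro q ⟨h1, h2⟩
      exact ⟨⟨h1.1, Metric.ball_subset_ball hMN' h1.2⟩, ⟨Metric.ball_subset_ball hMN' h2.1, h2.2⟩⟩
    · exact min_le_min le_rfl (by exact_mod_cast hMN)
  · refine Eventually.of_forall fun p => ?_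
    by_cases hp : p ∈ A ×ˢ Aᶜ
    · rw [Set.indicator_of_mem hp]
      have h1 : Tendsto (fun M : ℕ => min (K (p.1 - p.2)) (M : ℝ≥0∞)) atTop
          (𝓝 (K (p.1 - p.2))) := by
        have := (tendsto_const_nhds (x := K (p.1 - p.2))).min ENNReal.tendsto_nat_nhds_top
        simpa using this
      refine h1.congr' ?_
      obtain ⟨M₀, hM₀⟩ := exists_nat_gt (max ‖p.1‖ ‖p.2‖)
      filter_upwards [eventually_ge_atTop M₀] with M hM
      have hM' : max ‖p.1‖ ‖p.2‖ < M := hM₀.trans_le (by exact_mod_cast hM)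
      rw [Set.indicator_of_mem]
      exact ⟨⟨hp.1, mem_ball_zero_iff.2 ((le_max_left _ _).trans_lt hM')⟩,
        ⟨mem_ball_zero_iff.2 ((le_max_right _ _).trans_lt hM'), hp.2⟩⟩
    · rw [Set.indicator_of_notMem hp]
      refine tendsto_const_nhds.congr fun M => ?_
      rw [Set.indicator_of_notMem]
      exact fun h => hp ⟨h.1.1, h.2.2⟩

lemma truncPer_le_add {K : Vd d → ℝ≥0∞} (hK : Measurable K) (M : ℕ) {A B : Set (Vd d)}
    (hA : MeasurableSet A) (hB : MeasurableSet B) :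
    truncPer K M B ≤ truncPer K M A + 2 * (M * volume (Metric.ball (0 : Vd d) M)) *
      volume ((A ∆ B) ∩ Metric.ball 0 M) := by
  have hk : Measurable fun x => min (K x) (M : ℝ≥0∞) := by fun_prop
  have hb : ∀ S T : Set (Vd d), MeasurableSet S → MeasurableSet T →
      pairMeasure (fun x => min (K x) (M : ℝ≥0∞)) (S ×ˢ T) ≤ M * (volume S * volume T) := by
    intro S T hS hT
    rw [pairMeasure, withDensity_apply _ (hS.prod hT), ← Measure.prod_prod, ← setLIntegral_const]
    exact lintegral_mono fun p => min_le_right _ _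
  set b : Set (Vd d) := Metric.ball 0 M with hbdef
  have hbm : MeasurableSet b := measurableSet_ball
  set D : Set (Vd d) := (A ∆ B) ∩ b with hD
  have hDm : MeasurableSet D := (hA.symmDiff hB).inter hbm
  calc truncPer K M B ≤ pairMeasure (fun x => min (K x) (M : ℝ≥0∞))
        ((A ∩ b) ×ˢ (b \ A) ∪ (D ×ˢ b ∪ b ×ˢ D)) := by
        refine measure_mono ?_
        rintro ⟨x, y⟩ ⟨⟨h1, h2⟩, ⟨h3, h4⟩⟩
        simp only [hD, Set.mem_union, Set.mem_prod, Set.mem_inter_iff, Set.mem_sdiff,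
          Set.mem_symmDiff] at *
        tauto
    _ ≤ truncPer K M A + (M * (volume D * volume b) + M * (volume b * volume D)) :=
        (measure_union_le _ _).trans (add_le_add le_rfl ((measure_union_le _ _).trans
          (add_le_add (hb _ _ hDm hbm) (hb _ _ hbm hDm))))
    _ = _ := by ring

lemma sum_truncPer_shift_le {K : Vd d → ℝ≥0∞} (hK : Measurable K) (M : ℕ) {A : Set (Vd d)}
    (hA : MeasurableSet A) {J : Type*} (J₀ : Finset J) (h : J → Vd d)
    (hsep : ∀ i ∈ J₀, ∀ j ∈ J₀, i ≠ j → 2 * (M : ℝ) < ‖h i - h j‖) :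
    ∑ j ∈ J₀, truncPer K M (shift (h j) A) ≤ nlPer K A := by
  have hS : ∀ j, MeasurableSet ((A ∩ Metric.ball (h j) M) ×ˢ (Metric.ball (h j) M \ A)) := fun j =>
    (hA.inter measurableSet_ball).prod (measurableSet_ball.diff hA)
  have h1 : ∀ j, truncPer K M (shift (h j) A) ≤
      pairMeasure K ((A ∩ Metric.ball (h j) M) ×ˢ (Metric.ball (h j) M \ A)) := by
    intro j
    rw [← pairMeasure_shift hK (h j) (hA.inter measurableSet_ball) (measurableSet_ball.diff hA)]
    have e : shift (h j) (Metric.ball (h j) (M : ℝ)) = Metric.ball 0 (M : ℝ) := by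
      rw [shift_ball, sub_self]
    have e1 : shift (h j) (A ∩ Metric.ball (h j) M) = shift (h j) A ∩ Metric.ball 0 M := by
      rw [← e]; rfl
    have e2 : shift (h j) (Metric.ball (h j) M \ A) = Metric.ball 0 M \ shift (h j) A := by
      rw [← e]; rfl
    rw [e1, e2, truncPer, pairMeasure, pairMeasure]
    exact withDensity_mono (Eventually.of_forall fun p => min_le_left _ _) _
  refine (Finset.sum_le_sum fun j _ => h1 j).trans ?_
  rw [nlPer_eq hK hA, ← measure_biUnion_finset _ fun j _ => hS j]
  · refine measure_mono ?_
    intro p hp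
    obtain ⟨j, -, hj⟩ := Set.mem_iUnion₂.1 hp
    exact ⟨hj.1.1, hj.2.2⟩
  · intro i hi j hj hij
    refine Set.disjoint_left.2 fun p hp hq => ?_
    have h2 := hsep i hi j hj hij
    have h3 := Metric.mem_ball.1 hp.1.2
    have h4 := Metric.mem_ball.1 hq.1.2
    have h5 := dist_triangle_left (h i) (h j) p.1
    rw [← dist_eq_norm] at h2
    linarith

/-- Lower semicontinuity of the perimeter under splitting into pieces that drift apart. -/
lemma nlPer_iUnion_le_of_tendsto {K : Vd d → ℝ≥0∞} (hK : Measurable K) {F : Filter ℕ} [F.NeBot]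
    {A : ℕ → Set (Vd d)} (hA : ∀ n, MeasurableSet (A n)) {J : Type*} [Countable J]
    {h : J → ℕ → Vd d} (hsep : ∀ i j, i ≠ j → ∀ R : ℝ, ∀ᶠ n in F, R < ‖h i n - h j n‖)
    {A' : J → Set (Vd d)} (hA' : ∀ j, MeasurableSet (A' j))
    (hlim : ∀ j, TendstoLoc F (fun n => shift (h j n) (A n)) (A' j))
    {p : ℝ≥0∞} (hp : Tendsto (fun n => nlPer K (A n)) F (𝓝 p)) :
    nlPer K (⋃ j, A' j) ≤ p := by
  refine (nlPer_union_le hK hA').trans (ENNReal.summable.tsum_le_of_sum_le fun J₀ => ?_)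
  refine le_of_tendsto' (tendsto_finsetSum J₀ fun j _ => tendsto_truncPer hK (hA' j)) fun M => ?_
  set c : ℝ≥0∞ := 2 * (M * volume (Metric.ball (0 : Vd d) M)) with hc
  have hct : c ≠ ⊤ := by
    have : volume (Metric.ball (0 : Vd d) M) ≠ ⊤ := measure_ball_lt_top.ne
    finiteness
  have h1 : Tendsto (fun n => nlPer K (A n) + ∑ j ∈ J₀, c *
      volume ((shift (h j n) (A n) ∆ A' j) ∩ Metric.ball 0 M)) F (𝓝 p) := by
    have := hp.add (tendsto_finsetSum J₀ fun j _ =>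
      ENNReal.Tendsto.const_mul (hlim j M) (Or.inr hct))
    simpa using this
  refine ge_of_tendsto h1 ?_
  have h2 : ∀ᶠ n in F, ∀ i ∈ J₀, ∀ j ∈ J₀, i ≠ j → 2 * (M : ℝ) < ‖h i n - h j n‖ := by
    refine (eventually_all_finset _).2 fun i _ => (eventually_all_finset _).2 fun j _ => ?_
    by_cases hij : i = j
    · simp [hij]
    · filter_upwards [hsep i j hij (2 * M)] with n hn _ using hn
  filter_upwards [h2] with n hn
  refine (Finset.sum_le_sum fun j _ => truncPer_le_add hK M
    (measurableSet_shift (h j n) (hA n)) (hA' j)).trans ?_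
  rw [Finset.sum_add_distrib]
  exact add_le_add (sum_truncPer_shift_le hK M (hA n) J₀ (fun j => h j n) hn) le_rfl

/-- Sets of bounded perimeter and volume are covered, up to measure `ε`, by boundedly many
balls of radius `2`. -/
lemma exists_cover_balls {s C : ℝ} {K : Vd d → ℝ≥0∞} (hd : 1 ≤ d) (hs : 0 < s) (hC : 0 < C)
    (hK : IsKernel s C K) {P V : ℝ≥0∞} (hP : P ≠ ⊤) (hV : V ≠ ⊤) {ε : ℝ≥0∞} (hε : ε ≠ 0) :
    ∃ M : ℕ, ∀ D : Set (Vd d), MeasurableSet D → nlPer K D ≤ P → volume D = V →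
      ∃ x : Fin M → Vd d, volume (D \ ⋃ k, Metric.ball (x k) 2) ≤ ε := by
  classical
  obtain ⟨ρ, hρ, hρ1, hmaj⟩ := exists_majority hd hs hC hK hP hε
  set β : ℝ≥0∞ := volume (Metric.ball (0 : Vd d) ρ) / 2 with hβ
  have hβ0 : β ≠ 0 := by simp [hβ, (Metric.measure_ball_pos volume (0 : Vd d) hρ).ne']
  obtain ⟨M, hM⟩ := ENNReal.exists_nat_mul_gt hβ0 hV
  refine ⟨M, fun D hD hPD hVD => ?_⟩
  obtain ⟨W, hWε, hW⟩ := hmaj D hD hPD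
  by_contra! hcon
  have hstep : ∀ n ≤ M, ∃ X : Finset (Vd d), X.card = n ∧ (∀ x ∈ X, x ∈ D ∧ x ∉ W) ∧
      ∀ x ∈ X, ∀ y ∈ X, x ≠ y → 2 ≤ dist x y := by
    intro n
    induction n with
    | zero => exact fun _ => ⟨∅, by simp⟩
    | succ n ih =>
      intro hn
      obtain ⟨X, hXn, hXD, hXs⟩ := ih (by omega)
      set f : Fin M → Vd d := fun k => X.toList.getD k 0 with hf
      have hfX : ∀ x ∈ X, ∃ k, f k = x := by
        intro x hx
        obtain ⟨i, hi, hix⟩ := List.getElem_of_mem (Finset.mem_toList.2 hx)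
        have hi' : i < M := by rw [Finset.length_toList, hXn] at hi; omega
        exact ⟨⟨i, hi'⟩, by simp only [hf]; rw [List.getD_eq_getElem _ _ hi, hix]⟩
      obtain ⟨y, hy⟩ : ((D \ ⋃ k, Metric.ball (f k) 2) \ W).Nonempty := by
        by_contra hemp
        rw [Set.not_nonempty_iff_eq_empty, Set.sdiff_eq_empty] at hemp
        exact absurd ((measure_mono hemp).trans hWε) (not_le.2 (hcon f))
      have hyX : ∀ x ∈ X, 2 ≤ dist y x := by
        intro x hx
        obtain ⟨k, rfl⟩ := hfX x hx
        by_contra! h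
        exact hy.1.2 (Set.mem_iUnion.2 ⟨k, h⟩)
      have hynot : y ∉ X := fun h => by
        have := hyX y h
        rw [dist_self] at this
        linarith
      refine ⟨insert y X, by rw [Finset.card_insert_of_notMem hynot, hXn], ?_, ?_⟩
      · intro x hx
        rcases Finset.mem_insert.1 hx with rfl | hx
        · exact ⟨hy.1.1, hy.2⟩
        · exact hXD x hx
      · intro x hx z hz hxz
        rcases Finset.mem_insert.1 hx with hx' | hx' <;>
          rcases Finset.mem_insert.1 hz with hz' | hz'
        · exact absurd (hx'.trans hz'.symm) hxz
        · rw [hx']; exact hyX z hz'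
        · rw [hz', dist_comm]; exact hyX x hx'
        · exact hXs x hx' z hz' hxz
  obtain ⟨X, hXn, hXD, hXs⟩ := hstep M le_rfl
  have h1 : (M : ℝ≥0∞) * β ≤ V := by
    calc (M : ℝ≥0∞) * β = ∑ x ∈ X, β := by simp [hXn]
      _ ≤ ∑ x ∈ X, volume (D ∩ Metric.ball x ρ) := Finset.sum_le_sum fun x hx =>
          ((hW x (hXD x hx).2 x (by simpa using hρ)).1 (hXD x hx).1).le
      _ = volume (⋃ x ∈ X, D ∩ Metric.ball x ρ) := by
          refine (measure_biUnion_finset ?_ fun x _ => hD.inter measurableSet_ball).symm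
          intro x hx y hy hxy
          refine Set.disjoint_left.2 fun z hz1 hz2 => ?_
          have h3 := Metric.mem_ball.1 hz1.2
          have h4 := Metric.mem_ball.1 hz2.2
          have h5 := dist_triangle_left x y z
          have h6 := hXs x hx y hy hxy
          linarith
      _ ≤ volume D := measure_mono (Set.iUnion₂_subset fun x _ => Set.inter_subset_left)
      _ = V := hVD
  exact absurd h1 (not_le.2 hM)

lemma IsFundDom.volume_shift_inter {Γ : AddSubgroup (Vd d)} {D : Set (Vd d)}
    (h : IsFundDom (Γ : Set (Vd d)) D) {g g' : Vd d} (hg : g ∈ Γ) (hg' : g' ∈ Γ) (hne : g ≠ g') :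
    volume (shift g D ∩ shift g' D) = 0 := by
  have h1 := h.2.1 (g' - g) (Γ.sub_mem hg' hg) (sub_ne_zero.2 hne.symm)
  rw [setTranslate_eq_shift, ← volume_shift g'] at h1
  convert h1 using 2
  ext x
  simp [add_assoc]

lemma IsFundDom.card_mul_le {Γ : AddSubgroup (Vd d)} {D : Set (Vd d)}
    (h : IsFundDom (Γ : Set (Vd d)) D) (x : Vd d) (ρ R : ℝ) (S : Finset (Vd d))
    (hS : ∀ g ∈ S, g ∈ Γ ∧ ‖g‖ ≤ R) :
    S.card * volume (D ∩ Metric.ball x ρ) ≤ volume (Metric.ball (0 : Vd d) (ρ + R)) := by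
  have hm : ∀ g, MeasurableSet (shift g (D ∩ Metric.ball x ρ)) := fun g =>
    measurableSet_shift g (h.1.inter measurableSet_ball)
  calc S.card * volume (D ∩ Metric.ball x ρ)
      = ∑ g ∈ S, volume (shift g (D ∩ Metric.ball x ρ)) := by simp [volume_shift]
    _ = volume (⋃ g ∈ S, shift g (D ∩ Metric.ball x ρ)) := by
        refine (measure_biUnion_finset₀ ?_ fun g _ => (hm g).nullMeasurableSet).symm
        intro g hg g' hg' hne
        refine measure_mono_null ?_ (h.volume_shift_inter (hS g hg).1 (hS g' hg').1 hne)
        exact Set.inter_subset_inter (fun _ h => h.1) (fun _ h => h.1)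
    _ ≤ volume (Metric.ball x (ρ + R)) := by
        refine measure_mono (Set.iUnion₂_subset fun g hg y hy => ?_)
        have h1 := Metric.mem_ball.1 hy.2
        rw [Metric.mem_ball]
        have h2 : dist y x ≤ dist (y + g) x + dist y (y + g) := by
          rw [add_comm]; exact dist_triangle _ _ _
        have h3 : dist y (y + g) = ‖g‖ := by simp [dist_eq_norm]
        linarith [(hS g hg).2]
    _ = _ := by rw [Measure.addHaar_ball_center]

/-- Uniform bound on the number of lattice points in balls. -/
lemma exists_card_bound {s C : ℝ} {K : Vd d → ℝ≥0∞} (hd : 1 ≤ d) (hs : 0 < s) (hC : 0 < C)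
    (hK : IsKernel s C K) {P V : ℝ≥0∞} (hP : P ≠ ⊤) (hV : V ≠ 0) :
    ∃ m : ℝ → ℕ, ∀ (Γ : AddSubgroup (Vd d)) (D : Set (Vd d)), IsFundDom (Γ : Set (Vd d)) D →
      nlPer K D ≤ P → volume D = V → ∀ (R : ℝ) (S : Finset (Vd d)),
        (∀ g ∈ S, g ∈ Γ ∧ ‖g‖ ≤ R) → S.card ≤ m R := by
  obtain ⟨ε, hε0, hεV⟩ := exists_between (pos_iff_ne_zero.2 hV)
  obtain ⟨ρ, hρ, hρ1, hmaj⟩ := exists_majority hd hs hC hK hP hε0.ne'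
  set β : ℝ≥0∞ := volume (Metric.ball (0 : Vd d) ρ) / 2 with hβ
  have hβ0 : β ≠ 0 := by simp [hβ, (Metric.measure_ball_pos volume (0 : Vd d) hρ).ne']
  have hex : ∀ R : ℝ, ∃ n : ℕ, volume (Metric.ball (0 : Vd d) (ρ + R)) < n * β := fun R =>
    ENNReal.exists_nat_mul_gt hβ0 measure_ball_lt_top.ne
  choose m hm using hex
  refine ⟨m, fun Γ D hD hPD hVD R S hS => ?_⟩
  obtain ⟨W, hWε, hW⟩ := hmaj D hD.1 hPD
  obtain ⟨x, hxD, hxW⟩ : (D \ W).Nonempty := by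
    by_contra hemp
    rw [Set.not_nonempty_iff_eq_empty, Set.sdiff_eq_empty] at hemp
    exact absurd ((measure_mono hemp).trans hWε) (not_le.2 (hVD ▸ hεV))
  have h1 := ((hW x hxW x (by simpa using hρ)).1 hxD).le
  have h2 : (S.card : ℝ≥0∞) * β < m R * β :=
    (mul_le_mul_right h1 _).trans_lt ((hD.card_mul_le x ρ R S hS).trans_lt (hm R))
  have h3 : (S.card : ℝ≥0∞) < m R := lt_of_mul_lt_mul_right' h2
  exact_mod_cast h3.le

/-- The number of elements of `Γ` in balls of radius `R` is bounded by `m R`. -/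
def HasCardBound (m : ℝ → ℕ) (Γ : AddSubgroup (Vd d)) : Prop :=
  ∀ (R : ℝ) (S : Finset (Vd d)), (∀ g ∈ S, g ∈ Γ ∧ ‖g‖ ≤ R) → S.card ≤ m R

lemma HasCardBound.le_norm {m : ℝ → ℕ} {Γ : AddSubgroup (Vd d)} (h : HasCardBound m Γ)
    {g : Vd d} (hg : g ∈ Γ) (hg0 : g ≠ 0) : 1 / (m 1 + 1 : ℝ) ≤ ‖g‖ := by
  classical
  by_contra! hlt
  have hinj : Function.Injective fun j : ℕ => j • g := fun i j hij => by
    have : ((i : ℝ) - j) • g = 0 := by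
      rw [sub_smul, Nat.cast_smul_eq_nsmul, Nat.cast_smul_eq_nsmul]
      exact sub_eq_zero.2 hij
    rcases smul_eq_zero.1 this with h | h
    · exact_mod_cast sub_eq_zero.1 h
    · exact absurd h hg0
  have := h 1 ((Finset.range (m 1 + 1)).image fun j : ℕ => j • g) (by
    intro x hx
    obtain ⟨j, hj, rfl⟩ := Finset.mem_image.1 hx
    refine ⟨Γ.nsmul_mem hg j, ?_⟩
    have hj' : (j : ℝ) ≤ m 1 := by exact_mod_cast Nat.lt_succ_iff.1 (Finset.mem_range.1 hj)
    have hpos : (0 : ℝ) < m 1 + 1 := by positivity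
    rw [lt_div_iff₀ hpos] at hlt
    calc ‖j • g‖ = j * ‖g‖ := by rw [← Nat.cast_smul_eq_nsmul ℝ, norm_smul]; simp
      _ ≤ (m 1 + 1) * ‖g‖ := by gcongr; linarith
      _ ≤ 1 := by linarith)
  rw [Finset.card_image_of_injective _ hinj, Finset.card_range] at this
  omega

/-- Folding estimate: translates of `S` by a group cover little of a bounded set. -/
lemma HasCardBound.volume_inter_le {m : ℝ → ℕ} {Γ : AddSubgroup (Vd d)} [Countable Γ]
    (h : HasCardBound m Γ) {B S : Set (Vd d)} (hB : MeasurableSet B) (hS : MeasurableSet S)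
    {y : Vd d} {R : ℝ} (hBR : B ⊆ Metric.ball y R) :
    volume (B ∩ ⋃ g ∈ Γ, setTranslate g S) ≤ m (2 * R) * volume S := by
  classical
  have hS' : ∀ g, MeasurableSet (shift g B ∩ S) := fun g => (measurableSet_shift g hB).inter hS
  have hcount : ∀ x, ∑' g : Γ, (shift (g : Vd d) B).indicator (1 : Vd d → ℝ≥0∞) x ≤ m (2 * R) := by
    intro x
    refine ENNReal.summable.tsum_le_of_sum_le fun T => ?_
    set T' := T.filter fun g : Γ => x + (g : Vd d) ∈ B with hT'
    have hT : ∑ g ∈ T, (shift (g : Vd d) B).indicator (1 : Vd d → ℝ≥0∞) x = T'.card := by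
      simp [hT', Set.indicator_apply]
    rw [hT]
    rcases T'.eq_empty_or_nonempty with he | ⟨g₀, hg₀⟩
    · simp [he]
    have hinj : Function.Injective fun g : Γ => (g : Vd d) - g₀ := fun a b hab => by
      simpa using hab
    have := h (2 * R) (T'.image fun g : Γ => (g : Vd d) - g₀) (by
      intro z hz
      obtain ⟨g, hg, rfl⟩ := Finset.mem_image.1 hz
      refine ⟨Γ.sub_mem g.2 g₀.2, ?_⟩
      have h1 := Metric.mem_ball.1 (hBR (Finset.mem_filter.1 hg).2)
      have h2 := Metric.mem_ball.1 (hBR (Finset.mem_filter.1 hg₀).2)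
      have h3 := dist_triangle_right (x + (g : Vd d)) (x + (g₀ : Vd d)) y
      rw [dist_eq_norm, add_sub_add_left_eq_sub] at h3
      linarith)
    rw [Finset.card_image_of_injective _ hinj] at this
    exact_mod_cast this
  calc volume (B ∩ ⋃ g ∈ Γ, setTranslate g S)
      ≤ volume (⋃ g : Γ, B ∩ setTranslate (g : Vd d) S) := by
        refine measure_mono ?_
        rintro x ⟨hxB, hx⟩
        obtain ⟨g, hg, hxg⟩ := Set.mem_iUnion₂.1 hx
        exact Set.mem_iUnion.2 ⟨⟨g, hg⟩, hxB, hxg⟩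
    _ ≤ ∑' g : Γ, volume (B ∩ setTranslate (g : Vd d) S) := measure_iUnion_le _
    _ = ∑' g : Γ, ∫⁻ x in S, (shift (g : Vd d) B).indicator 1 x := by
        refine tsum_congr fun g => ?_
        rw [lintegral_indicator_one (measurableSet_shift _ hB),
          Measure.restrict_apply (measurableSet_shift _ hB), setTranslate_eq_shift,
          ← volume_shift (g : Vd d)]
        congr 1
        ext x
        simp
    _ = ∫⁻ x in S, ∑' g : Γ, (shift (g : Vd d) B).indicator 1 x :=
        (lintegral_tsum fun g =>
          (measurable_one.indicator (measurableSet_shift _ hB)).aemeasurable).symm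
    _ ≤ ∫⁻ x in S, m (2 * R) := lintegral_mono hcount
    _ = m (2 * R) * volume S := by simp

lemma IsFundDom.volume_le {m : ℝ → ℕ} {Γ : AddSubgroup (Vd d)} [Countable Γ] {D : Set (Vd d)}
    (hD : IsFundDom (Γ : Set (Vd d)) D) (h : HasCardBound m Γ) {B S : Set (Vd d)}
    (hB : MeasurableSet B) (hS : MeasurableSet S) {y : Vd d} {R : ℝ} (hBR : B ⊆ Metric.ball y R) :
    volume B ≤ volume (B ∩ ⋃ g ∈ Γ, setTranslate g (D ∩ S)) + m (2 * R) * volume (D \ S) := by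
  calc volume B ≤ volume ((Set.univ \ ⋃ g ∈ Γ, setTranslate g D) ∪
        ((B ∩ ⋃ g ∈ Γ, setTranslate g (D ∩ S)) ∪ (B ∩ ⋃ g ∈ Γ, setTranslate g (D \ S)))) := by
        refine measure_mono fun x hx => ?_
        by_cases hxD : x ∈ ⋃ g ∈ Γ, setTranslate g D
        · right
          obtain ⟨g, hg, z, hz, rfl⟩ := Set.mem_iUnion₂.1 hxD
          by_cases hzS : z ∈ S
          · exact Or.inl ⟨hx, Set.mem_iUnion₂.2 ⟨g, hg, z, ⟨hz, hzS⟩, rfl⟩⟩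
          · exact Or.inr ⟨hx, Set.mem_iUnion₂.2 ⟨g, hg, z, ⟨hz, hzS⟩, rfl⟩⟩
        · exact Or.inl ⟨trivial, hxD⟩
    _ ≤ 0 + (_ + _) := (measure_union_le _ _).trans
        (add_le_add hD.2.2.le (measure_union_le _ _))
    _ ≤ _ := by
        rw [zero_add]
        exact add_le_add le_rfl (h.volume_inter_le hB (hD.1.diff hS) hBR)

/-- Uniform bound on the covering radius. -/
lemma exists_covering_radius {s C : ℝ} {K : Vd d → ℝ≥0∞} (hd : 1 ≤ d) (hs : 0 < s) (hC : 0 < C)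
    (hK : IsKernel s C K) {P V : ℝ≥0∞} (hP : P ≠ ⊤) (hV : V ≠ ⊤) (m : ℝ → ℕ) :
    ∃ R₀ : ℝ, ∀ (Γ : AddSubgroup (Vd d)) [Countable Γ] (D : Set (Vd d)),
      IsFundDom (Γ : Set (Vd d)) D → nlPer K D ≤ P → volume D = V → HasCardBound m Γ →
        ∀ y : Vd d, ∃ g ∈ Γ, ‖y - g‖ ≤ R₀ := by
  have hω : volume (Metric.ball (0 : Vd d) 1) ≠ 0 := (Metric.measure_ball_pos volume _ one_pos).ne'
  obtain ⟨ε, hε0, hε⟩ : ∃ ε : ℝ≥0∞, ε ≠ 0 ∧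
      m (2 * 1) * ε < volume (Metric.ball (0 : Vd d) 1) := by
    obtain ⟨n, hn0, hn⟩ := ENNReal.exists_nat_pos_inv_mul_lt
      (a := (m (2 * 1) : ℝ≥0∞)) (by simp) hω
    exact ⟨(n : ℝ≥0∞)⁻¹, by simp, by rwa [mul_comm]⟩
  obtain ⟨M, hM⟩ := exists_cover_balls hd hs hC hK hP hV hε0
  refine ⟨7 * M + 1, fun Γ _ D hD hPD hVD hm y => ?_⟩
  obtain ⟨x, hx⟩ := hM D hD.1 hPD hVD
  have hnear : ∀ p : Vd d, ∃ k, ∃ g ∈ Γ, ‖p - (x k + g)‖ < 3 := by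
    intro p
    by_contra! hcon
    have h1 := hD.volume_le hm (B := Metric.ball p 1) (S := ⋃ k, Metric.ball (x k) 2)
      measurableSet_ball (MeasurableSet.iUnion fun k => measurableSet_ball) subset_rfl
    have h2 : Metric.ball p 1 ∩ ⋃ g ∈ Γ, setTranslate g (D ∩ ⋃ k, Metric.ball (x k) 2) = ∅ := by
      refine Set.eq_empty_of_forall_notMem ?_
      rintro _ ⟨hz1, hz⟩
      obtain ⟨g, hg, z, ⟨-, hz2⟩, rfl⟩ := Set.mem_iUnion₂.1 hz
      obtain ⟨k, hk⟩ := Set.mem_iUnion.1 hz2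
      have h3 := hcon k g hg
      have h4 := Metric.mem_ball'.1 hz1
      have h5 : dist (z + g) (x k + g) < 2 := by simpa using hk
      have h6 := dist_triangle p (z + g) (x k + g)
      rw [← dist_eq_norm] at h3
      simp only at h4
      linarith
    rw [h2, measure_empty, zero_add, Measure.addHaar_ball_center] at h1
    exact absurd (h1.trans (mul_le_mul_right hx _)) (not_le.2 hε)
  have hne : (Γ : Set (Vd d)).Nonempty := ⟨0, Γ.zero_mem⟩
  have hdist : Metric.infDist y (Γ : Set (Vd d)) < 7 * M + 1 := by
    by_contra! hfar
    set φ : ℝ → ℝ := fun t => Metric.infDist (t • y) (Γ : Set (Vd d)) with hφ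
    have hφc : Continuous φ := (Metric.continuous_infDist_pt _).comp (by fun_prop)
    have hφ0 : φ 0 = 0 := by
      simp only [hφ, zero_smul]
      exact Metric.infDist_zero_of_mem Γ.zero_mem
    have hφ1 : φ 1 = Metric.infDist y (Γ : Set (Vd d)) := by simp [hφ]
    have hex : ∀ j : Fin (M + 1), ∃ t, φ t = 7 * (j : ℝ) := by
      intro j
      have hj : ((j : ℕ) : ℝ) ≤ M := by exact_mod_cast Nat.lt_succ_iff.1 j.2
      have := intermediate_value_Icc zero_le_one hφc.continuousOn
        (show 7 * ((j : ℕ) : ℝ) ∈ Set.Icc (φ 0) (φ 1) from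
          ⟨by rw [hφ0]; positivity, by rw [hφ1]; linarith⟩)
      obtain ⟨t, -, ht⟩ := this
      exact ⟨t, ht⟩
    choose t ht using hex
    choose k g hg hkg using fun j => hnear (t j • y)
    obtain ⟨i, j, hij, hk⟩ := Fintype.exists_ne_map_eq_of_card_lt k (by simp)
    have hle : ∀ i j, k i = k j → φ (t i) ≤ φ (t j) + 6 := by
      intro i j hk
      refine le_of_forall_pos_lt_add fun δ hδ => ?_
      obtain ⟨a, ha, hya⟩ := (Metric.infDist_lt_iff hne).1
        (show Metric.infDist (t j • y) (Γ : Set (Vd d)) < φ (t j) + δ by simp only [hφ]; linarith)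
      have hmem : a + (g i - g j) ∈ (Γ : Set (Vd d)) :=
        Γ.add_mem ha (Γ.sub_mem (hg i) (hg j))
      refine (Metric.infDist_le_dist_of_mem hmem).trans_lt ?_
      have h1 := hkg i
      have h2 := hkg j
      rw [hk] at h1
      rw [dist_eq_norm] at hya ⊢
      have e : t i • y - (a + (g i - g j)) =
          (t j • y - a) + ((t i • y - (x (k j) + g i)) - (t j • y - (x (k j) + g j))) := by abel
      rw [e]
      have h3 := norm_add_le (t j • y - a)
        ((t i • y - (x (k j) + g i)) - (t j • y - (x (k j) + g j)))
      have h4 := norm_sub_le (t i • y - (x (k j) + g i)) (t j • y - (x (k j) + g j))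
      linarith
    have h1 := hle i j hk
    have h2 := hle j i hk.symm
    rw [ht, ht] at h1 h2
    have hij' : (i : ℕ) ≠ j := fun h => hij (Fin.ext h)
    rcases lt_or_gt_of_ne hij' with h | h
    · have : ((i : ℕ) : ℝ) + 1 ≤ (j : ℕ) := by exact_mod_cast h
      linarith
    · have : ((j : ℕ) : ℝ) + 1 ≤ (i : ℕ) := by exact_mod_cast h
      linarith
  obtain ⟨g, hg, hyg⟩ := (Metric.infDist_lt_iff hne).1 hdist
  exact ⟨g, hg, by rw [← dist_eq_norm]; exact hyg.le⟩

lemma exists_separated_reps {ι : Type} (U : Ultrafilter ℕ) (g : ι → ℕ → Vd d) :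
    ∃ J : Set ι, (∀ i ∈ J, ∀ j ∈ J, i ≠ j → ∀ R : ℝ, ∀ᶠ n in U, R < ‖g i n - g j n‖) ∧
      ∀ a, ∃ j ∈ J, ∃ R : ℝ, ∀ᶠ n in U, ‖g a n - g j n‖ ≤ R := by
  let S : Setoid ι :=
    { r := fun a b => ∃ R : ℝ, ∀ᶠ n in U, ‖g a n - g b n‖ ≤ R
      iseqv :=
        { refl := fun a => ⟨0, by simp⟩
          symm := fun {a b} ⟨R, hR⟩ => ⟨R, by simpa only [norm_sub_rev] using hR⟩
          trans := fun {a b c} ⟨R, hR⟩ ⟨R', hR'⟩ => ⟨R + R', by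
            filter_upwards [hR, hR'] with n h1 h2
            exact (norm_sub_le_norm_sub_add_norm_sub _ (g b n) _).trans (add_le_add h1 h2)⟩ } }
  refine ⟨Set.range (Quotient.out : Quotient S → ι), ?_, fun a => ?_⟩
  · rintro _ ⟨q, rfl⟩ _ ⟨q', rfl⟩ hne R
    by_contra hcon
    have h1 : S.r q.out q'.out :=
      ⟨R, (Ultrafilter.eventually_not.2 hcon).mono fun n hn => not_lt.1 hn⟩
    exact hne (congrArg Quotient.out (Quotient.out_equiv_out.1 h1))
  · have h1 : S.r a (Quotient.mk S a).out := S.symm (Quotient.mk_out a)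
    exact ⟨_, ⟨_, rfl⟩, h1⟩

/-- A tight sequence of fundamental domains splits into countably many pieces which stay close
to lattice points escaping from each other. -/
lemma exists_tight_centers {M : ℕ → ℕ} {R₀ : ℝ} (U : Ultrafilter ℕ) {Γ : ℕ → AddSubgroup (Vd d)}
    {D : ℕ → Set (Vd d)} (hR₀ : ∀ n y, ∃ g ∈ Γ n, ‖y - g‖ ≤ R₀)
    (hM : ∀ k n, ∃ x : Fin (M k) → Vd d,
      volume (D n \ ⋃ a, Metric.ball (x a) 2) ≤ ((k : ℝ≥0∞))⁻¹) :
    ∃ (J : Set (Σ k, Fin (M k))) (h : J → ℕ → Vd d), (∀ j n, h j n ∈ Γ n) ∧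
      (∀ i j, i ≠ j → ∀ R : ℝ, ∀ᶠ n in U, R < ‖h i n - h j n‖) ∧
      ∀ ε : ℝ≥0∞, ε ≠ 0 → ∃ (J₀ : Finset J) (R : ℝ), ∀ᶠ n in U,
        volume (D n \ ⋃ j ∈ J₀, Metric.ball (h j n) R) ≤ ε := by
  classical
  choose x hx using hM
  choose g hg hgR using hR₀
  obtain ⟨J, hsep, hrep⟩ := exists_separated_reps U
    fun (a : Σ k, Fin (M k)) n => g n (x a.1 n a.2)
  refine ⟨J, fun j n => g n (x j.1.1 n j.1.2), fun j n => hg _ _,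
    fun i j hij => hsep i i.2 j j.2 fun h => hij (Subtype.ext h), fun ε hε => ?_⟩
  choose r hrJ R hR using hrep
  obtain ⟨k, hk⟩ := ENNReal.exists_inv_nat_lt hε
  refine ⟨Finset.univ.image fun a : Fin (M k) => ⟨r ⟨k, a⟩, hrJ _⟩,
    2 + R₀ + ∑ a : Fin (M k), |R ⟨k, a⟩|, ?_⟩
  filter_upwards [eventually_all.2 fun a : Fin (M k) => hR ⟨k, a⟩] with n hn
  refine (measure_mono ?_).trans ((hx k n).trans hk.le)
  refine Set.sdiff_subset_sdiff_right (Set.iUnion_subset fun a y hy => ?_)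
  refine Set.mem_iUnion₂.2 ⟨⟨r ⟨k, a⟩, hrJ _⟩, Finset.mem_image_of_mem _ (Finset.mem_univ a), ?_⟩
  have h1 := Metric.mem_ball.1 hy
  have h2 := hgR n (x k n a)
  have h3 := hn a
  have h4 : |R ⟨k, a⟩| ≤ ∑ a : Fin (M k), |R ⟨k, a⟩| :=
    Finset.single_le_sum (f := fun a : Fin (M k) => |R ⟨k, a⟩|) (fun _ _ => abs_nonneg _)
      (Finset.mem_univ a)
  rw [← dist_eq_norm] at h2 h3
  have h5 := dist_triangle4 y (x k n a) (g n (x k n a)) (g n (x (r ⟨k, a⟩).1 n (r ⟨k, a⟩).2))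
  have h6 := le_abs_self (R ⟨k, a⟩)
  rw [Metric.mem_ball]
  linarith

/-- The set of limits of sequences of elements of `Γ n`. -/
def limitLattice (U : Ultrafilter ℕ) (Γ : ℕ → AddSubgroup (Vd d)) : AddSubgroup (Vd d) where
  carrier := {g | ∃ γ : ℕ → Vd d, (∀ n, γ n ∈ Γ n) ∧ Tendsto γ U (𝓝 g)}
  zero_mem' := ⟨0, fun n => (Γ n).zero_mem, tendsto_const_nhds⟩
  add_mem' := fun ⟨γ, h1, h2⟩ ⟨γ', h1', h2'⟩ =>
    ⟨γ + γ', fun n => (Γ n).add_mem (h1 n) (h1' n), h2.add h2'⟩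
  neg_mem' := fun ⟨γ, h1, h2⟩ => ⟨-γ, fun n => (Γ n).neg_mem (h1 n), h2.neg⟩

lemma exists_tendsto_of_norm_le (U : Ultrafilter ℕ) {γ : ℕ → Vd d} {R : ℝ} (y : Vd d)
    (h : ∀ n, ‖y - γ n‖ ≤ R) : ∃ g, ‖y - g‖ ≤ R ∧ Tendsto γ U (𝓝 g) := by
  obtain ⟨g, hg, hU⟩ := (isCompact_closedBall y R).ultrafilter_le_nhds (U.map γ) (by
    simp only [le_principal_iff, Ultrafilter.mem_coe, Ultrafilter.mem_map]
    filter_upwards with n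
    simpa [dist_eq_norm, norm_sub_rev] using h n)
  exact ⟨g, by simpa [dist_eq_norm, norm_sub_rev] using hg, hU⟩

lemma exists_mem_limitLattice {U : Ultrafilter ℕ} {Γ : ℕ → AddSubgroup (Vd d)} {R₀ : ℝ}
    (hR₀ : ∀ n y, ∃ g ∈ Γ n, ‖y - g‖ ≤ R₀) (y : Vd d) :
    ∃ g ∈ limitLattice U Γ, ‖y - g‖ ≤ R₀ := by
  choose γ hγ hγR using fun n => hR₀ n y
  obtain ⟨g, hg, hlim⟩ := exists_tendsto_of_norm_le U y hγR
  exact ⟨g, ⟨γ, hγ, hlim⟩, hg⟩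

lemma le_norm_of_mem_limitLattice {U : Ultrafilter ℕ} {Γ : ℕ → AddSubgroup (Vd d)} {r : ℝ}
    (h : ∀ n, ∀ g ∈ Γ n, g ≠ 0 → r ≤ ‖g‖) {g : Vd d} (hg : g ∈ limitLattice U Γ) (hg0 : g ≠ 0) :
    r ≤ ‖g‖ := by
  obtain ⟨γ, hγ, hlim⟩ := hg
  refine ge_of_tendsto hlim.norm ?_
  filter_upwards [hlim.eventually_ne hg0] with n hn
  exact h n _ (hγ n) hn

/-- The pieces `E' i j` are the limits of partitions `E n i` of fundamental domains `D n` seen from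
lattice points `h j n` which escape from each other and carry all the volume. -/
structure IsSplitLimit (U : Ultrafilter ℕ) (m : ℝ → ℕ) (Γ : ℕ → AddSubgroup (Vd d))
    (D : ℕ → Set (Vd d)) {N : ℕ} (v : Fin N → ℝ) (E : ℕ → Fin N → Set (Vd d)) {J : Type}
    (h : J → ℕ → Vd d) (E' : Fin N → J → Set (Vd d)) : Prop where
  fundDom : ∀ n, IsFundDom (Γ n : Set (Vd d)) (D n)
  part : ∀ n, AdmissiblePart (D n) v (E n)
  countable : ∀ n, Countable (Γ n)
  cardBound : ∀ n, HasCardBound m (Γ n)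
  mem : ∀ j n, h j n ∈ Γ n
  sep : ∀ i j, i ≠ j → ∀ R : ℝ, ∀ᶠ n in U, R < ‖h i n - h j n‖
  tight : ∀ ε : ℝ≥0∞, ε ≠ 0 → ∃ (J₀ : Finset J) (R : ℝ), ∀ᶠ n in U,
    volume (D n \ ⋃ j ∈ J₀, Metric.ball (h j n) R) ≤ ε
  meas : ∀ i j, MeasurableSet (E' i j)
  lim : ∀ i j, TendstoLoc U (fun n => shift (h j n) (E n i)) (E' i j)

lemma volume_inter_le_add_symmDiff (A B S : Set (Vd d)) :
    volume (A ∩ S) ≤ volume (B ∩ S) + volume ((A ∆ B) ∩ S) := by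
  refine (measure_mono fun x hx => ?_).trans (measure_union_le _ _)
  simp only [Set.mem_union, Set.mem_inter_iff, Set.mem_symmDiff] at hx ⊢
  tauto

lemma volume_shift_inter_ball (h : Vd d) (A : Set (Vd d)) (R : ℝ) :
    volume (shift h A ∩ Metric.ball 0 R) = volume (A ∩ Metric.ball h R) := by
  rw [← volume_shift h (A ∩ Metric.ball h R)]
  congr 1
  ext x
  simp

namespace IsSplitLimit

variable {U : Ultrafilter ℕ} {m : ℝ → ℕ} {Γ : ℕ → AddSubgroup (Vd d)}
  {D : ℕ → Set (Vd d)} {N : ℕ} {v : Fin N → ℝ} {E : ℕ → Fin N → Set (Vd d)} {J : Type}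
  {h : J → ℕ → Vd d} {E' : Fin N → J → Set (Vd d)}

lemma volume_inter_shift_eq_zero (H : IsSplitLimit U m Γ D v E h E') {i i' : Fin N} {j j' : J}
    {g : Vd d} (hg : g ∈ limitLattice U Γ) (hne : i ≠ i' ∨ j ≠ j' ∨ g ≠ 0) :
    volume (E' i j ∩ shift g (E' i' j')) = 0 := by
  obtain ⟨γ, hγ, hlim⟩ := hg
  refine (H.lim i j).volume_inter_eq_zero ((H.lim i' j').shift (H.meas _ _) hlim) ?_
  have hev : ∀ᶠ n in U, i ≠ i' ∨ h j n ≠ γ n + h j' n := by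
    by_cases hi : i = i'
    · by_cases hj : j = j'
      · have hg0 : g ≠ 0 := by tauto
        filter_upwards [hlim.eventually_ne hg0] with n hn
        right
        rw [hj]
        simpa using hn
      · filter_upwards [H.sep j j' hj (‖g‖ + 1),
          hlim.norm.eventually (gt_mem_nhds (lt_add_one ‖g‖))] with n h1 h2
        right
        intro h3
        rw [h3, add_sub_cancel_right] at h1
        exact lt_asymm h1 h2
    · exact Eventually.of_forall fun _ => Or.inl hi
  filter_upwards [hev] with n hn
  rw [shift_shift]
  obtain ⟨-, hsub, -, hdisj, -⟩ := H.part n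
  by_cases heq : h j n = γ n + h j' n
  · rw [← heq]
    have := hdisj i i' (by tauto)
    rw [← volume_shift (h j n)] at this
    exact this
  · refine measure_mono_null ?_ ((H.fundDom n).volume_shift_inter (H.mem j n)
      ((Γ n).add_mem (hγ n) (H.mem j' n)) heq)
    exact Set.inter_subset_inter (fun x hx => hsub i hx) (fun x hx => hsub i' hx)

lemma volume_inter_eq_zero (H : IsSplitLimit U m Γ D v E h E') {i i' : Fin N} {j j' : J}
    (hne : i ≠ i' ∨ j ≠ j') : volume (E' i j ∩ E' i' j') = 0 := by
  have := H.volume_inter_shift_eq_zero (i := i) (i' := i') (j := j) (j' := j')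
    (limitLattice U Γ).zero_mem (by tauto)
  simpa [shift] using this

lemma tendsto_sum_volume (H : IsSplitLimit U m Γ D v E h E') (i : Fin N) (J₀ : Finset J)
    (R : ℝ) : Tendsto (fun n => ∑ j ∈ J₀, volume ((shift (h j n) (E n i) ∆ E' i j) ∩
      Metric.ball 0 R)) U (𝓝 0) := by
  simpa using tendsto_finsetSum J₀ fun j _ => H.lim i j R

lemma sum_volume_inter_le (H : IsSplitLimit U m Γ D v E h E') (i : Fin N) (J₀ : Finset J)
    (M : ℝ) : ∑ j ∈ J₀, volume (E' i j ∩ Metric.ball 0 M) ≤ ENNReal.ofReal (v i) := by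
  have hlim := (tendsto_const_nhds (x := ENNReal.ofReal (v i))).add
    (H.tendsto_sum_volume i J₀ M)
  rw [add_zero] at hlim
  refine ge_of_tendsto hlim ?_
  have hsep : ∀ᶠ n in U, ∀ a ∈ J₀, ∀ b ∈ J₀, a ≠ b → 2 * M < ‖h a n - h b n‖ := by
    refine (eventually_all_finset _).2 fun a _ => (eventually_all_finset _).2 fun b _ => ?_
    by_cases hab : a = b
    · simp [hab]
    · filter_upwards [H.sep a b hab (2 * M)] with n hn _ using hn
  filter_upwards [hsep] with n hn
  obtain ⟨hE, -, hvol, -, -⟩ := H.part n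
  calc ∑ j ∈ J₀, volume (E' i j ∩ Metric.ball 0 M)
      ≤ ∑ j ∈ J₀, (volume (E n i ∩ Metric.ball (h j n) M) +
          volume ((shift (h j n) (E n i) ∆ E' i j) ∩ Metric.ball 0 M)) := by
        refine Finset.sum_le_sum fun j _ => ?_
        rw [← volume_shift_inter_ball (h j n), symmDiff_comm (shift (h j n) (E n i)) (E' i j)]
        exact volume_inter_le_add_symmDiff (E' i j) (shift (h j n) (E n i)) _
    _ = volume (⋃ j ∈ J₀, E n i ∩ Metric.ball (h j n) M) +
          ∑ j ∈ J₀, volume ((shift (h j n) (E n i) ∆ E' i j) ∩ Metric.ball 0 M) := by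
        rw [Finset.sum_add_distrib, measure_biUnion_finset _
          fun j _ => (hE i).inter measurableSet_ball]
        intro a ha b hb hab
        refine Set.disjoint_left.2 fun z hz1 hz2 => ?_
        have h1 := hn a ha b hb hab
        have h2 := Metric.mem_ball.1 hz1.2
        have h3 := Metric.mem_ball.1 hz2.2
        have h4 := dist_triangle_left (h a n) (h b n) z
        rw [← dist_eq_norm] at h1
        linarith
    _ ≤ _ := by
        refine add_le_add ?_ le_rfl
        rw [← hvol i]
        exact measure_mono (Set.iUnion₂_subset fun _ _ => Set.inter_subset_left)

lemma sum_volume_le (H : IsSplitLimit U m Γ D v E h E') (i : Fin N) (J₀ : Finset J) :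
    ∑ j ∈ J₀, volume (E' i j) ≤ ENNReal.ofReal (v i) := by
  have hmono : ∀ j, Tendsto (fun M : ℕ => volume (E' i j ∩ Metric.ball 0 (M : ℝ))) atTop
      (𝓝 (volume (E' i j))) := fun j => by
    have := tendsto_measure_iUnion_atTop (μ := (volume : Measure (Vd d)))
      (s := fun M : ℕ => E' i j ∩ Metric.ball (0 : Vd d) (M : ℝ)) fun a b hab =>
        Set.inter_subset_inter_right _ (Metric.ball_subset_ball (by exact_mod_cast hab))
    rwa [← Set.inter_iUnion, Metric.iUnion_ball_nat, Set.inter_univ] at this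
  refine le_of_tendsto' (tendsto_finsetSum J₀ fun j _ => hmono j)
    fun M => H.sum_volume_inter_le i J₀ M

lemma volume_iUnion [Countable J] (H : IsSplitLimit U m Γ D v E h E') (i : Fin N) :
    volume (⋃ j, E' i j) = ENNReal.ofReal (v i) := by
  refine le_antisymm ((measure_iUnion_le _).trans
    (ENNReal.summable.tsum_le_of_sum_le (H.sum_volume_le i))) ?_
  refine ENNReal.le_of_forall_pos_le_add fun ε hε _ => ?_
  obtain ⟨J₀, R, hJ₀⟩ := H.tight ε (by exact_mod_cast hε.ne')
  have hlim := (tendsto_const_nhds (x := volume (⋃ j, E' i j) + ε)).add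
    (H.tendsto_sum_volume i J₀ R)
  rw [add_zero] at hlim
  refine ge_of_tendsto hlim ?_
  filter_upwards [hJ₀] with n hn
  obtain ⟨-, hsub, hvol, -, -⟩ := H.part n
  calc ENNReal.ofReal (v i) = volume (E n i) := (hvol i).symm
    _ ≤ volume ((D n \ ⋃ j ∈ J₀, Metric.ball (h j n) R) ∪
          ⋃ j ∈ J₀, E n i ∩ Metric.ball (h j n) R) := by
        refine measure_mono fun x hx => ?_
        by_cases hxB : x ∈ ⋃ j ∈ J₀, Metric.ball (h j n) R
        · obtain ⟨j, hj, hxj⟩ := Set.mem_iUnion₂.1 hxB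
          exact Or.inr (Set.mem_iUnion₂.2 ⟨j, hj, hx, hxj⟩)
        · exact Or.inl ⟨hsub i hx, hxB⟩
    _ ≤ ε + ∑ j ∈ J₀, volume (E n i ∩ Metric.ball (h j n) R) :=
        (measure_union_le _ _).trans (add_le_add hn (measure_biUnion_finset_le _ _))
    _ ≤ ε + ∑ j ∈ J₀, (volume (E' i j) +
          volume ((shift (h j n) (E n i) ∆ E' i j) ∩ Metric.ball 0 R)) := by
        gcongr with j hj
        rw [← volume_shift_inter_ball]
        exact (volume_inter_le_add_symmDiff _ (E' i j) _).trans
          (add_le_add (measure_mono Set.inter_subset_left) le_rfl)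
    _ = ε + (volume (⋃ j ∈ J₀, E' i j) +
          ∑ j ∈ J₀, volume ((shift (h j n) (E n i) ∆ E' i j) ∩ Metric.ball 0 R)) := by
        rw [Finset.sum_add_distrib, measure_biUnion_finset₀ _
          fun j _ => (H.meas i j).nullMeasurableSet]
        exact fun a _ b _ hab => H.volume_inter_eq_zero (Or.inr hab)
    _ ≤ ε + (volume (⋃ j, E' i j) +
          ∑ j ∈ J₀, volume ((shift (h j n) (E n i) ∆ E' i j) ∩ Metric.ball 0 R)) := by
        refine add_le_add le_rfl (add_le_add (measure_mono ?_) le_rfl)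
        exact Set.iUnion₂_subset fun j _ => Set.subset_iUnion (E' i) j
    _ = _ := by ring

lemma tendstoLoc_fundDom (H : IsSplitLimit U m Γ D v E h E') (j : J) :
    TendstoLoc U (fun n => shift (h j n) (D n)) (⋃ i, E' i j) := by
  refine TendstoLoc.of_symmDiff_subset (Z := fun n => shift (h j n) (D n \ ⋃ i, E n i))
    (fun i => H.lim i j) (fun n => ?_) fun n x hx => ?_
  · rw [volume_shift]
    exact (H.part n).2.2.2.2
  · have hsub := (H.part n).2.1
    rcases Set.mem_symmDiff.1 hx with ⟨h1, h2⟩ | ⟨h1, h2⟩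
    · by_cases hxE : x + h j n ∈ ⋃ i, E n i
      · obtain ⟨i, hi⟩ := Set.mem_iUnion.1 hxE
        exact Or.inr (Set.mem_iUnion.2 ⟨i, Or.inl ⟨hi, fun h3 => h2 (Set.mem_iUnion.2 ⟨i, h3⟩)⟩⟩)
      · exact Or.inl ⟨h1, hxE⟩
    · obtain ⟨i, hi⟩ := Set.mem_iUnion.1 h1
      exact Or.inr (Set.mem_iUnion.2 ⟨i, Or.inr ⟨hi, fun h3 => h2 (hsub i h3)⟩⟩)

end IsSplitLimit

lemma discreteTopology_of_le_norm {G : AddSubgroup (Vd d)} {r : ℝ} (hr : 0 < r)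
    (h : ∀ g ∈ G, g ≠ 0 → r ≤ ‖g‖) : DiscreteTopology G := by
  refine DiscreteTopology.of_forall_le_dist hr fun x y hxy => ?_
  beta_reduce
  rw [Subtype.dist_eq, dist_eq_norm]
  exact h _ (G.sub_mem x.2 y.2) (sub_ne_zero.2 fun h => hxy (Subtype.ext h))

lemma HasCardBound.exists_enum {m : ℝ → ℕ} {Γ : AddSubgroup (Vd d)} (h : HasCardBound m Γ)
    (R : ℝ) : ∃ f : Fin (m R) → Vd d, (∀ a, f a ∈ Γ ∧ ‖f a‖ ≤ |R|) ∧
      ∀ g ∈ Γ, ‖g‖ ≤ R → ∃ a, f a = g := by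
  have hfin : {g | g ∈ Γ ∧ ‖g‖ ≤ R}.Finite := by
    by_contra hinf
    obtain ⟨T, hT, hcard⟩ := Set.Infinite.exists_subset_card_eq hinf (m R + 1)
    have := h R T fun g hg => hT hg
    omega
  have hcard := h R hfin.toFinset fun g hg => hfin.mem_toFinset.1 hg
  refine ⟨fun k => hfin.toFinset.toList.getD k 0, fun a => ?_, fun g hg hgR => ?_⟩
  · beta_reduce
    by_cases ha : (a : ℕ) < hfin.toFinset.toList.length
    · rw [List.getD_eq_getElem _ _ ha]
      have := hfin.mem_toFinset.1 (Finset.mem_toList.1 (List.getElem_mem ha))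
      exact ⟨this.1, this.2.trans (le_abs_self R)⟩
    · rw [List.getD_eq_default _ _ (not_lt.1 ha)]
      exact ⟨Γ.zero_mem, by simp⟩
  · obtain ⟨i, hi, hix⟩ := List.getElem_of_mem (Finset.mem_toList.2 (hfin.mem_toFinset.2 ⟨hg, hgR⟩))
    have hi' : i < m R := by rw [Finset.length_toList] at hi; omega
    exact ⟨⟨i, hi'⟩, by simp only; rw [List.getD_eq_getElem _ _ hi, hix]⟩

namespace IsSplitLimit

variable {U : Ultrafilter ℕ} {m : ℝ → ℕ} {Γ : ℕ → AddSubgroup (Vd d)}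
  {D : ℕ → Set (Vd d)} {N : ℕ} {v : Fin N → ℝ} {E : ℕ → Fin N → Set (Vd d)} {J : Type}
  {h : J → ℕ → Vd d} {E' : Fin N → J → Set (Vd d)}

lemma discreteTopology (H : IsSplitLimit U m Γ D v E h E') :
    DiscreteTopology (limitLattice U Γ) :=
  discreteTopology_of_le_norm (r := 1 / (m 1 + 1 : ℝ)) (by positivity) fun _ hg hg0 =>
    le_norm_of_mem_limitLattice (fun n _ hγ hγ0 => (H.cardBound n).le_norm hγ hγ0) hg hg0

lemma countable_limitLattice (H : IsSplitLimit U m Γ D v E h E') :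
    Countable (limitLattice U Γ) := by
  have := H.discreteTopology
  exact countable_of_Lindelof_of_discrete

lemma eventually_volume_le (H : IsSplitLimit U m Γ D v E h E') {B : Set (Vd d)} {R : ℝ}
    (hBR : B ⊆ Metric.ball 0 R)
    (hB0 : ∀ g ∈ limitLattice U Γ, ∀ j, volume (B ∩ shift (-g) (⋃ i, E' i j)) = 0)
    (J₀ : Finset J) (R' : ℝ) :
    Tendsto (fun n => volume (B ∩ ⋃ γ ∈ Γ n, setTranslate γ
      (D n ∩ ⋃ j ∈ J₀, Metric.ball (h j n) R'))) U (𝓝 0) := by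
  choose f hf hfs using fun n => (H.cardBound n).exists_enum (R + R')
  have hlim : ∀ a, ∃ g, ‖0 - g‖ ≤ |R + R'| ∧ Tendsto (fun n => f n a) U (𝓝 g) := fun a =>
    exists_tendsto_of_norm_le U 0 fun n => by simpa using (hf n a).2
  choose g _ hg using hlim
  have hgG : ∀ a, g a ∈ limitLattice U Γ := fun a => ⟨_, fun n => (hf n a).1, hg a⟩
  have hmeas : ∀ j, MeasurableSet (⋃ i, E' i j) := fun j => MeasurableSet.iUnion fun i => H.meas i j
  have h0 : Tendsto (fun n => ∑ j ∈ J₀, ∑ a, volume ((shift (-f n a) (shift (h j n) (D n)) ∆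
      shift (-g a) (⋃ i, E' i j)) ∩ Metric.ball 0 R)) U (𝓝 0) := by
    have := tendsto_finsetSum J₀ fun j _ => tendsto_finsetSum Finset.univ fun a _ =>
      (H.tendstoLoc_fundDom j).shift (hmeas j) (hg a).neg R
    simpa using this
  refine tendsto_of_tendsto_of_tendsto_of_le_of_le tendsto_const_nhds h0 (fun _ => bot_le)
    fun n => ?_
  calc volume (B ∩ ⋃ γ ∈ Γ n, setTranslate γ (D n ∩ ⋃ j ∈ J₀, Metric.ball (h j n) R'))
      ≤ volume (⋃ j ∈ J₀, ⋃ a, B ∩ shift (-f n a) (shift (h j n) (D n))) := by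
        refine measure_mono ?_
        rintro _ ⟨hxB, hx⟩
        obtain ⟨γ, hγ, x, ⟨hxD, hxj⟩, rfl⟩ := Set.mem_iUnion₂.1 hx
        obtain ⟨j, hj, hxj⟩ := Set.mem_iUnion₂.1 hxj
        have h1 := Metric.mem_ball.1 (hBR hxB)
        have h2 := Metric.mem_ball'.1 hxj
        rw [dist_zero_right] at h1
        rw [dist_eq_norm] at h2
        simp only at h1
        obtain ⟨a, ha⟩ := hfs n (γ + h j n) ((Γ n).add_mem hγ (H.mem j n)) (by
          rw [show γ + h j n = (x + γ) + (h j n - x) by abel]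
          exact (norm_add_le _ _).trans (by linarith))
        refine Set.mem_iUnion₂.2 ⟨j, hj, Set.mem_iUnion.2 ⟨a, hxB, ?_⟩⟩
        simp only [mem_shift, ha]
        rwa [show x + γ + -(γ + h j n) + h j n = x by abel]
    _ ≤ ∑ j ∈ J₀, ∑ a, volume (B ∩ shift (-f n a) (shift (h j n) (D n))) :=
        (measure_biUnion_finset_le _ _).trans
          (Finset.sum_le_sum fun j _ => measure_iUnion_fintype_le _ _)
    _ ≤ _ := by
        refine Finset.sum_le_sum fun j _ => Finset.sum_le_sum fun a _ => ?_
        refine (measure_mono fun x hx => ?_).trans ((measure_union_le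
          (B ∩ shift (-g a) (⋃ i, E' i j)) _).trans
          (add_le_add (hB0 _ (hgG a) j).le le_rfl)) |>.trans (zero_add _).le
        by_cases hxE : x ∈ shift (-g a) (⋃ i, E' i j)
        · exact Or.inl ⟨hx.1, hxE⟩
        · exact Or.inr ⟨Or.inl ⟨hx.2, hxE⟩, hBR hx.1⟩

lemma volume_univ_diff [Countable J] (H : IsSplitLimit U m Γ D v E h E') :
    volume (Set.univ \ ⋃ g ∈ limitLattice U Γ, setTranslate g (⋃ i, ⋃ j, E' i j)) = 0 := by
  have := H.countable_limitLattice
  have hmeas : MeasurableSet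
      (Set.univ \ ⋃ g ∈ limitLattice U Γ, setTranslate g (⋃ i, ⋃ j, E' i j)) := by
    refine MeasurableSet.univ.diff (MeasurableSet.biUnion (Set.countable_coe_iff.1 this) ?_)
    intro g _
    rw [setTranslate_eq_shift]
    exact measurableSet_shift _ (MeasurableSet.iUnion fun i => MeasurableSet.iUnion (H.meas i))
  refine volume_eq_zero_of_forall_inter_ball fun R => ?_
  set B := (Set.univ \ ⋃ g ∈ limitLattice U Γ, setTranslate g (⋃ i, ⋃ j, E' i j)) ∩
    Metric.ball 0 R with hB
  have hBR : B ⊆ Metric.ball 0 R := Set.inter_subset_right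
  have hB0 : ∀ g ∈ limitLattice U Γ, ∀ j, volume (B ∩ shift (-g) (⋃ i, E' i j)) = 0 := by
    intro g hg j
    convert measure_empty (μ := (volume : Measure (Vd d)))
    refine Set.eq_empty_of_forall_notMem fun x hx => hx.1.1.2 ?_
    refine Set.mem_iUnion₂.2 ⟨g, hg, ?_⟩
    rw [setTranslate_eq_shift]
    obtain ⟨i, hi⟩ := Set.mem_iUnion.1 hx.2
    exact Set.mem_iUnion.2 ⟨i, Set.mem_iUnion.2 ⟨j, hi⟩⟩
  have hle : ∀ ε : ℝ≥0∞, ε ≠ 0 → volume B ≤ m (2 * R) * ε := by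
    intro ε hε
    obtain ⟨J₀, R', hJ₀⟩ := H.tight ε hε
    have hlim := (H.eventually_volume_le hBR hB0 J₀ R').add
      (tendsto_const_nhds (x := m (2 * R) * ε))
    rw [zero_add] at hlim
    refine ge_of_tendsto hlim ?_
    filter_upwards [hJ₀] with n hn
    have := H.countable n
    refine ((H.fundDom n).volume_le (H.cardBound n) (hmeas.inter measurableSet_ball)
      (S := ⋃ j ∈ J₀, Metric.ball (h j n) R')
      (Finset.measurableSet_biUnion _ fun j _ => measurableSet_ball) hBR).trans ?_
    gcongr
  have h1 : Tendsto (fun k : ℕ => (m (2 * R) : ℝ≥0∞) * (k : ℝ≥0∞)⁻¹) atTop (𝓝 0) := by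
    simpa using ENNReal.Tendsto.const_mul ENNReal.tendsto_inv_nat_nhds_zero
      (Or.inr (ENNReal.natCast_ne_top (m (2 * R))))
  exact le_antisymm (ge_of_tendsto' h1 fun k => hle _ (by simp)) bot_le

lemma isFundDom [Countable J] (H : IsSplitLimit U m Γ D v E h E') :
    IsFundDom (limitLattice U Γ : Set (Vd d)) (⋃ i, ⋃ j, E' i j) := by
  refine ⟨MeasurableSet.iUnion fun i => MeasurableSet.iUnion (H.meas i), fun g hg hg0 => ?_,
    H.volume_univ_diff⟩
  rw [setTranslate_eq_shift, Set.inter_comm]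
  refine measure_mono_null (t := ⋃ i, ⋃ j, ⋃ i', ⋃ j', E' i j ∩ shift (-g) (E' i' j')) ?_ ?_
  · rintro x ⟨hx, hx'⟩
    simp only [Set.mem_iUnion, mem_shift] at hx hx' ⊢
    obtain ⟨i, j, hij⟩ := hx
    obtain ⟨i', j', hij'⟩ := hx'
    exact ⟨i, j, i', j', hij, hij'⟩
  · simp only [measure_iUnion_null_iff]
    exact fun i j i' j' => H.volume_inter_shift_eq_zero
      ((limitLattice U Γ).neg_mem hg) (by simp [hg0])

lemma admissiblePart [Countable J] (H : IsSplitLimit U m Γ D v E h E') :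
    AdmissiblePart (⋃ i, ⋃ j, E' i j) v (fun i => ⋃ j, E' i j) := by
  refine ⟨fun i => MeasurableSet.iUnion (H.meas i), fun i => Set.subset_iUnion (fun i => ⋃ j, E' i j) i,
    H.volume_iUnion, fun i i' hne => ?_, by simp⟩
  simp only [Set.iUnion_inter_iUnion, measure_iUnion_null_iff]
  exact fun _ _ => H.volume_inter_eq_zero (Or.inl hne)

end IsSplitLimit

lemma span_eq_top_of_dense {Γ : AddSubgroup (Vd d)} {R₀ : ℝ}
    (h : ∀ y : Vd d, ∃ g ∈ Γ, ‖y - g‖ ≤ R₀) : Submodule.span ℝ (Γ : Set (Vd d)) = ⊤ := by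
  rw [← Submodule.orthogonal_eq_bot_iff, Submodule.eq_bot_iff]
  intro y hy
  by_contra hy0
  have hn : 0 < ‖y‖ := norm_pos_iff.2 hy0
  obtain ⟨g, hg, hgR⟩ := h (((R₀ + 1) / ‖y‖) • y)
  have h1 : inner ℝ g y = 0 :=
    (Submodule.mem_orthogonal _ _).1 hy g (Submodule.subset_span hg)
  have h2 := real_inner_le_norm ((((R₀ + 1) / ‖y‖) • y) - g) y
  rw [inner_sub_left, h1, real_inner_smul_left, real_inner_self_eq_norm_sq] at h2
  have h3 : (R₀ + 1) / ‖y‖ * ‖y‖ ^ 2 = (R₀ + 1) * ‖y‖ := by field_simp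
  nlinarith [mul_le_mul_of_nonneg_right hgR hn.le]

lemma IsFundDom.isAddFundamentalDomain {Γ : Submodule ℤ (Vd d)} {D : Set (Vd d)}
    [Countable Γ] (h : IsFundDom (Γ : Set (Vd d)) D) :
    IsAddFundamentalDomain Γ D (volume : Measure (Vd d)) where
  nullMeasurableSet := h.1.nullMeasurableSet
  ae_covers := by
    have h1 := h.2.2
    rw [← Set.compl_eq_univ_sdiff] at h1
    filter_upwards [compl_mem_ae_iff.2 h1] with x hx
    rw [compl_compl] at hx
    obtain ⟨g, hg, y, hy, rfl⟩ := Set.mem_iUnion₂.1 hx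
    refine ⟨⟨-g, Γ.neg_mem hg⟩, ?_⟩
    rw [Submodule.vadd_def, vadd_eq_add]
    simpa using hy
  aedisjoint := by
    have hkey : ∀ g : Γ, (fun x => g +ᵥ x) '' D = shift (-(g : Vd d)) D := fun g => by
      rw [← setTranslate_eq_shift]
      exact Set.image_congr fun x _ => by rw [Submodule.vadd_def, vadd_eq_add, add_comm]
    intro g g' hne
    change volume ((fun x => g +ᵥ x) '' D ∩ (fun x => g' +ᵥ x) '' D) = 0
    rw [hkey, hkey]
    exact IsFundDom.volume_shift_inter (Γ := Γ.toAddSubgroup) h (Γ.neg_mem g.2) (Γ.neg_mem g'.2)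
      fun h => hne (Subtype.ext (neg_injective h))

lemma volume_real_fundamentalDomain_basisFun :
    (volume : Measure (Vd d)).real
      (ZSpan.fundamentalDomain (EuclideanSpace.basisFun (Fin d) ℝ).toBasis) = 1 := by
  rw [measureReal_congr (ZSpan.fundamentalDomain_ae_parallelepiped _ volume)]
  simp only [OrthonormalBasis.coe_toBasis, measureReal_def, OrthonormalBasis.volume_parallelepiped,
    ENNReal.toReal_one]

lemma isLatticeWithVol_of_isFundDom {Γ : AddSubgroup (Vd d)} [DiscreteTopology Γ] {R₀ V : ℝ}
    (hd : ∀ y : Vd d, ∃ g ∈ Γ, ‖y - g‖ ≤ R₀) {D : Set (Vd d)} (hV : 0 ≤ V)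
    (hD : IsFundDom (Γ : Set (Vd d)) D) (hDV : volume D = ENNReal.ofReal V) :
    IsLatticeWithVol (Γ : Set (Vd d)) V := by
  set S : Submodule ℤ (Vd d) := AddSubgroup.toIntSubmodule Γ with hS
  have hdisc : DiscreteTopology S := ‹DiscreteTopology Γ›
  have hlat : IsZLattice ℝ S := ⟨span_eq_top_of_dense hd⟩
  have hrank : Module.finrank ℤ S = d := by
    rw [ZLattice.rank ℝ S, finrank_euclideanSpace_fin]
  let b : Module.Basis (Fin d) ℤ S := Module.finBasisOfFinrankEq ℤ S hrank
  have hspan := Module.Basis.ofZLatticeBasis_span ℝ S b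
  refine ⟨fun i => b i, ?_, ?_, ?_⟩
  · have e : (fun i => (b i : Vd d)) = b.ofZLatticeBasis ℝ S := by
      ext1 i
      simp
    rw [e]
    exact (b.ofZLatticeBasis ℝ S).linearIndependent
  · ext x
    have h1 : x ∈ S ↔ x ∈ Submodule.span ℤ (Set.range (b.ofZLatticeBasis ℝ S)) := by rw [hspan]
    change x ∈ S ↔ _
    rw [h1, Submodule.mem_span_range_iff_exists_fun]
    simp only [Module.Basis.ofZLatticeBasis_apply, latticeOf, Set.mem_ofPred_eq,
      Int.cast_smul_eq_zsmul, eq_comm]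
  · have hF : IsAddFundamentalDomain S D (volume : Measure (Vd d)) :=
      IsFundDom.isAddFundamentalDomain (Γ := S) hD
    have h1 := ZLattice.covolume_eq_measure_fundamentalDomain S volume hF
    have h2 := ZLattice.covolume_eq_det_mul_measureReal S volume b
      (EuclideanSpace.basisFun (Fin d) ℝ).toBasis
    rw [volume_real_fundamentalDomain_basisFun, mul_one, h1, measureReal_def, hDV,
      ENNReal.toReal_ofReal hV, Module.Basis.det_apply] at h2
    rw [h2]
    rfl

/-- The box `[a, b) × [0, L) × ⋯ × [0, L)`. -/
def slab (d : ℕ) (L a b : ℝ) : Set (Vd (d + 1)) :=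
  {x | x 0 ∈ Set.Ico a b ∧ ∀ i : Fin d, x i.succ ∈ Set.Ico 0 L}

lemma slab_eq_preimage (L a b : ℝ) : slab d L a b =
    (MeasurableEquiv.toLp 2 (Fin (d + 1) → ℝ)).symm ⁻¹'
      Set.pi Set.univ fun i =>
        Set.Ico (Fin.cases a (fun _ => 0) i : ℝ) (Fin.cases b (fun _ => L) i) := by
  ext x
  simp [slab, Fin.forall_fin_succ]

lemma measurableSet_slab (L a b : ℝ) : MeasurableSet (slab d L a b) := by
  rw [slab_eq_preimage]
  exact (MeasurableEquiv.measurable _) (MeasurableSet.univ_pi fun _ => measurableSet_Ico)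

lemma volume_slab (L a b : ℝ) :
    volume (slab d L a b) = ENNReal.ofReal (b - a) * ENNReal.ofReal L ^ d := by
  rw [slab_eq_preimage, (EuclideanSpace.volume_preserving_symm_measurableEquiv_toLp
    (Fin (d + 1))).measure_preimage
      (MeasurableSet.univ_pi fun _ => measurableSet_Ico).nullMeasurableSet, Real.volume_pi_Ico,
    Fin.prod_univ_succ]
  simp

lemma exists_isLatticeWithVol_slab {L : ℝ} (hL : 0 < L) :
    ∃ G : Set (Vd (d + 1)), IsLatticeWithVol G (L ^ (d + 1)) ∧ IsFundDom G (slab d L 0 L) := by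
  set b : Fin (d + 1) → Vd (d + 1) := fun i => L • EuclideanSpace.single i (1 : ℝ) with hb
  have hcoord : ∀ (k : Fin (d + 1) → ℤ) i, (∑ j, (k j : ℝ) • b j) i = k i * L := by
    intro k i
    simp [hb, Finset.sum_apply, Pi.single_apply]
  have hmem : ∀ x : Vd (d + 1), x ∈ slab d L 0 L ↔ ∀ i, x i ∈ Set.Ico 0 L := fun x => by
    simp [slab, Fin.forall_fin_succ]
  refine ⟨latticeOf b, ⟨b, ?_, rfl, ?_⟩, measurableSet_slab _ _ _, ?_, ?_⟩
  · have h1 := (EuclideanSpace.basisFun (Fin (d + 1)) ℝ).toBasis.linearIndependent.units_smul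
      fun _ => Units.mk0 L hL.ne'
    have e : b = (fun _ : Fin (d + 1) => Units.mk0 L hL.ne') •
        ⇑(EuclideanSpace.basisFun (Fin (d + 1)) ℝ).toBasis := by
      ext1 i
      simp [hb, Units.smul_def]
    rw [e]
    exact h1
  · have : (Matrix.of fun i j => b j i) = Matrix.diagonal fun _ : Fin (d + 1) => L := by
      ext i j
      simp [hb, Matrix.diagonal_apply]
    rw [this, Matrix.det_diagonal]
    simp [abs_of_pos (pow_pos hL _)]
  · rintro _ ⟨k, rfl⟩ hne
    convert measure_empty (μ := (volume : Measure (Vd (d + 1))))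
    refine Set.eq_empty_of_forall_notMem ?_
    rintro _ ⟨⟨z, hz, rfl⟩, hx⟩
    refine hne (Finset.sum_eq_zero fun i _ => ?_)
    have h1 := (hmem _).1 hz i
    have h2 := (hmem _).1 hx i
    rw [PiLp.add_apply, hcoord] at h2
    have h3 : (k i : ℝ) * L < 1 * L := by linarith [h1.1, h2.2]
    have h4 : (-1) * L < (k i : ℝ) * L := by linarith [h1.2, h2.1]
    have h5 : k i < 1 := by exact_mod_cast lt_of_mul_lt_mul_right h3 hL.le
    have h6 : -1 < k i := by exact_mod_cast lt_of_mul_lt_mul_right h4 hL.le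
    have h7 : k i = 0 := by omega
    simp [h7]
  · convert measure_empty (μ := (volume : Measure (Vd (d + 1))))
    refine Set.eq_empty_of_forall_notMem fun x hx => hx.2 ?_
    refine Set.mem_iUnion₂.2 ⟨_, ⟨fun i => ⌊x i / L⌋, rfl⟩, x - ∑ j, ((⌊x j / L⌋ : ℤ) : ℝ) • b j,
      (hmem _).2 fun i => ?_, sub_add_cancel _ _⟩
    rw [PiLp.sub_apply, hcoord fun i => ⌊x i / L⌋]
    have h1 := Int.floor_le (x i / L)
    have h2 := Int.lt_floor_add_one (x i / L)
    rw [le_div_iff₀ hL] at h1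
    rw [div_lt_iff₀ hL] at h2
    constructor <;> linarith

lemma exists_admissiblePart_slab {L : ℝ} (hL : 0 < L) {N : ℕ} {v : Fin N → ℝ} (hv : ∀ i, 0 < v i)
    (hsum : ∑ i, v i = L ^ (d + 1)) : ∃ E, AdmissiblePart (slab d L 0 L) v E := by
  classical
  set w : ℕ → ℝ := fun n => if h : n < N then v ⟨n, h⟩ else 0 with hw
  have hw0 : ∀ n, 0 ≤ w n := fun n => by
    simp only [hw]
    split_ifs with h
    exacts [(hv _).le, le_rfl]
  set a : ℕ → ℝ := fun n => (∑ j ∈ Finset.range n, w j) / L ^ d with ha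
  have hasucc : ∀ n, a (n + 1) = a n + w n / L ^ d := fun n => by
    simp only [ha, Finset.sum_range_succ, add_div]
  have hmono : Monotone a := monotone_nat_of_le_succ fun n => by
    have := div_nonneg (hw0 n) (pow_pos hL d).le
    rw [hasucc]
    linarith
  have ha0 : a 0 = 0 := by simp [ha]
  have haN : a N = L := by
    have : ∑ j ∈ Finset.range N, w j = L ^ (d + 1) := by
      rw [← hsum, Finset.sum_range]
      exact Finset.sum_congr rfl fun i _ => by simp [hw]
    simp only [ha, this]
    rw [pow_succ, mul_div_cancel_left₀ _ (pow_pos hL d).ne']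
  refine ⟨fun i => slab d L (a i) (a (i + 1)), fun i => measurableSet_slab _ _ _, fun i x hx => ?_,
    fun i => ?_, fun i j hij => ?_, ?_⟩
  · refine ⟨⟨?_, ?_⟩, hx.2⟩
    · exact (ha0.symm.le.trans (hmono (Nat.zero_le _))).trans hx.1.1
    · exact hx.1.2.trans_le (haN ▸ hmono i.2)
  · rw [volume_slab, hasucc, add_sub_cancel_left, ← ENNReal.ofReal_pow hL.le,
      ← ENNReal.ofReal_mul (div_nonneg (hw0 _) (pow_pos hL d).le)]
    congr 1
    rw [div_mul_cancel₀ _ (pow_pos hL d).ne']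
    simp [hw]
  · convert measure_empty (μ := (volume : Measure (Vd (d + 1))))
    refine Set.eq_empty_of_forall_notMem fun x hx => ?_
    have h1 := hmono.pairwise_disjoint_on_Ico_succ (fun h => hij (Fin.ext h))
    exact Set.disjoint_left.1 h1 hx.1.1 hx.2.1
  · convert measure_empty (μ := (volume : Measure (Vd (d + 1))))
    refine Set.eq_empty_of_forall_notMem fun x hx => hx.2 ?_
    have hex : ∃ n, x 0 < a n := ⟨N, haN ▸ hx.1.1.2⟩
    obtain ⟨n, hn⟩ : ∃ n, Nat.find hex = n + 1 := by
      refine Nat.exists_eq_succ_of_ne_zero fun h0 => ?_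
      have h1 := Nat.find_spec hex
      rw [h0, ha0] at h1
      exact absurd hx.1.1.1 (not_le.2 h1)
    have hnN : n < N := by
      have := Nat.find_min' hex (show x 0 < a N from haN ▸ hx.1.1.2)
      omega
    refine Set.mem_iUnion.2 ⟨⟨n, hnN⟩, ⟨?_, ?_⟩, hx.1.2⟩
    · exact not_lt.1 (Nat.find_min hex (hn ▸ Nat.lt_succ_self n))
    · have := Nat.find_spec hex
      rwa [hn] at this

lemma exists_addSubgroup_of_isLatticeWithVol {G : Set (Vd d)} {V : ℝ}
    (h : IsLatticeWithVol G V) : ∃ Γ : AddSubgroup (Vd d), (Γ : Set (Vd d)) = G ∧ Countable Γ := by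
  obtain ⟨b, -, rfl, -⟩ := h
  refine ⟨(Submodule.span ℤ (Set.range b)).toAddSubgroup, ?_, ?_⟩
  · ext x
    change x ∈ Submodule.span ℤ (Set.range b) ↔ _
    rw [Submodule.mem_span_range_iff_exists_fun]
    simp only [latticeOf, Set.mem_ofPred_eq, Int.cast_smul_eq_zsmul, eq_comm]
  · exact inferInstanceAs (Countable (Submodule.span ℤ (Set.range b)))

lemma AdmissiblePart.ae_eq {D : Set (Vd d)} {N : ℕ} {v : Fin N → ℝ} {E : Fin N → Set (Vd d)}
    (h : AdmissiblePart D v E) : D =ᵐ[volume] ⋃ i, E i :=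
  (ae_le_set.2 h.2.2.2.2).antisymm (Set.iUnion_subset h.2.1).eventuallyLE

lemma AdmissiblePart.volume_eq {D : Set (Vd d)} {N : ℕ} {v : Fin N → ℝ} {E : Fin N → Set (Vd d)}
    (h : AdmissiblePart D v E) (hv : ∀ i, 0 < v i) : volume D = ENNReal.ofReal (∑ i, v i) := by
  rw [measure_congr h.ae_eq, measure_iUnion₀ (fun i j hij => h.2.2.2.1 i j hij)
    fun i => (h.1 i).nullMeasurableSet, tsum_fintype, ENNReal.ofReal_sum_of_nonneg
    fun i _ => (hv i).le]
  exact Finset.sum_congr rfl fun i _ => h.2.2.1 i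

lemma AdmissiblePart.nlPer_le {K : Vd d → ℝ≥0∞} (hK : Measurable K) {D : Set (Vd d)} {N : ℕ}
    {v : Fin N → ℝ} {E : Fin N → Set (Vd d)} (h : AdmissiblePart D v E) :
    nlPer K D ≤ ∑ i, nlPer K (E i) := by
  rw [nlPer_congr_ae h.ae_eq]
  exact (nlPer_union_le hK h.1).trans (tsum_fintype _).le

lemma exists_tendsto_ultrafilter (U : Ultrafilter ℕ) (f : ℕ → ℝ≥0∞) : ∃ p, Tendsto f U (𝓝 p) := by
  obtain ⟨p, -, hp⟩ := isCompact_univ.ultrafilter_le_nhds (U.map f) (by simp)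
  exact ⟨p, hp⟩

/-- Sequences of partitioned fundamental domains with bounded perimeters have limits, along
which the perimeters are lower semicontinuous. -/
lemma exists_limit_of_nlPer_le {s C : ℝ} {K : Vd d → ℝ≥0∞} (hd : 1 ≤ d) (hs : 0 < s) (hC : 0 < C)
    (hK : IsKernel s C K) {P : ℝ≥0∞} (hP : P ≠ ⊤) {V : ℝ} (hV : 0 < V) {N : ℕ} {v : Fin N → ℝ}
    (hv : ∀ i, 0 < v i) (hsum : ∑ i, v i = V) (U : Ultrafilter ℕ) {G D : ℕ → Set (Vd d)}
    {E : ℕ → Fin N → Set (Vd d)} (hG : ∀ n, IsLatticeWithVol (G n) V)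
    (hGD : ∀ n, IsFundDom (G n) (D n)) (hE : ∀ n, AdmissiblePart (D n) v (E n))
    (hEP : ∀ n i, nlPer K (E n i) ≤ P) {pD : ℝ≥0∞} {p : Fin N → ℝ≥0∞}
    (hpD : Tendsto (fun n => nlPer K (D n)) U (𝓝 pD))
    (hp : ∀ i, Tendsto (fun n => nlPer K (E n i)) U (𝓝 (p i))) :
    ∃ (G' D' : Set (Vd d)) (E' : Fin N → Set (Vd d)), IsLatticeWithVol G' V ∧ IsFundDom G' D' ∧
      AdmissiblePart D' v E' ∧ nlPer K D' ≤ pD ∧ ∀ i, nlPer K (E' i) ≤ p i := by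
  have hKm := hK.1.1
  choose Γ hΓ hcount using fun n => exists_addSubgroup_of_isLatticeWithVol (hG n)
  simp only [← hΓ] at hGD
  set Q : ℝ≥0∞ := N * P with hQ
  have hQt : Q ≠ ⊤ := by finiteness
  have hDQ : ∀ n, nlPer K (D n) ≤ Q := fun n => by
    refine ((hE n).nlPer_le hKm).trans ((Finset.sum_le_sum fun i _ => hEP n i).trans ?_)
    simp [hQ]
  have hDV : ∀ n, volume (D n) = ENNReal.ofReal V := fun n => hsum ▸ (hE n).volume_eq hv
  have hV0 : ENNReal.ofReal V ≠ 0 := by simpa using hV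
  obtain ⟨m, hm⟩ := exists_card_bound hd hs hC hK hQt hV0
  have hcard : ∀ n, HasCardBound m (Γ n) := fun n => hm (Γ n) (D n) (hGD n) (hDQ n) (hDV n)
  obtain ⟨R₀, hR₀⟩ := exists_covering_radius hd hs hC hK hQt (ENNReal.ofReal_ne_top (r := V)) m
  have hdense : ∀ n y, ∃ g ∈ Γ n, ‖y - g‖ ≤ R₀ := fun n =>
    hR₀ (Γ n) (D n) (hGD n) (hDQ n) (hDV n) (hcard n)
  choose M hM using fun k : ℕ => exists_cover_balls hd hs hC hK hQt
    (ENNReal.ofReal_ne_top (r := V)) (ε := (k : ℝ≥0∞)⁻¹) (by simp)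
  obtain ⟨J, h, hmem, hsep, htight⟩ := exists_tight_centers U hdense
    fun k n => hM k (D n) (hGD n).1 (hDQ n) (hDV n)
  have hlim : ∀ i j, ∃ B, MeasurableSet B ∧ TendstoLoc U (fun n => shift (h j n) (E n i)) B :=
    fun i j => exists_tendstoLoc hd hs hC hK hP U
      (fun n => measurableSet_shift _ ((hE n).1 i))
      fun n => (nlPer_shift hKm _ ((hE n).1 i)).trans_le (hEP n i)
  choose B hB hBlim using hlim
  have H : IsSplitLimit U m Γ D v E h B :=
    { fundDom := hGD
      part := hE
      countable := hcount
      cardBound := hcard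
      mem := hmem
      sep := hsep
      tight := htight
      meas := hB
      lim := hBlim }
  have := H.discreteTopology
  refine ⟨limitLattice U Γ, ⋃ i, ⋃ j, B i j, fun i => ⋃ j, B i j,
    isLatticeWithVol_of_isFundDom (exists_mem_limitLattice hdense) hV.le H.isFundDom
      (hsum ▸ H.admissiblePart.volume_eq hv), H.isFundDom, H.admissiblePart, ?_, fun i => ?_⟩
  · rw [Set.iUnion_comm]
    exact nlPer_iUnion_le_of_tendsto hKm (fun n => (hGD n).1) hsep
      (fun j => MeasurableSet.iUnion fun i => hB i j) H.tendstoLoc_fundDom hpD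
  · exact nlPer_iUnion_le_of_tendsto hKm (fun n => (hE n).1 i) hsep (hB i) (hBlim i) (hp i)

theorem stmt2 {d : ℕ} (hd : 1 ≤ d) (s C : ℝ) (hs : s ∈ Set.Ioo (0:ℝ) 1) (hC : 0 < C)
    (K : Vd d → ℝ≥0∞) (hK : IsKernel s C K)
    (L μ : ℝ) (hL : 0 < L) (hμ : 0 ≤ μ)
    (N : ℕ) (v : Fin N → ℝ) (hv : ∀ i, 0 < v i) (hsum : ∑ i, v i = L ^ d) :
    ∃ (G : Set (Vd d)) (D : Set (Vd d)) (E : Fin N → Set (Vd d)),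
      IsLatticeWithVol G (L ^ d) ∧ IsFundDom G D ∧ AdmissiblePart D v E ∧
      sInf {c : ℝ≥0∞ | ∃ (G' D' : Set (Vd d)) (E' : Fin N → Set (Vd d)),
          IsLatticeWithVol G' (L ^ d) ∧ IsFundDom G' D' ∧ AdmissiblePart D' v E' ∧
          c = ENNReal.ofReal μ * nlPer K D' + 2⁻¹ * ∑ i, nlPer K (E' i)} =
        ENNReal.ofReal μ * nlPer K D + 2⁻¹ * ∑ i, nlPer K (E i) := by
  set S := {c : ℝ≥0∞ | ∃ (G' D' : Set (Vd d)) (E' : Fin N → Set (Vd d)),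
    IsLatticeWithVol G' (L ^ d) ∧ IsFundDom G' D' ∧ AdmissiblePart D' v E' ∧
    c = ENNReal.ofReal μ * nlPer K D' + 2⁻¹ * ∑ i, nlPer K (E' i)} with hS
  obtain ⟨G₀, D₀, E₀, hG₀, hD₀, hE₀⟩ : ∃ (G D : Set (Vd d)) (E : Fin N → Set (Vd d)),
      IsLatticeWithVol G (L ^ d) ∧ IsFundDom G D ∧ AdmissiblePart D v E := by
    obtain ⟨d, rfl⟩ := Nat.exists_eq_add_of_le' hd
    obtain ⟨G, hG, hGD⟩ := exists_isLatticeWithVol_slab (d := d) hL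
    obtain ⟨E, hE⟩ := exists_admissiblePart_slab (d := d) hL hv hsum
    exact ⟨G, _, E, hG, hGD, hE⟩
  have hne : S.Nonempty := ⟨_, G₀, D₀, E₀, hG₀, hD₀, hE₀, rfl⟩
  by_cases htop : sInf S = ⊤
  · refine ⟨G₀, D₀, E₀, hG₀, hD₀, hE₀, ?_⟩
    exact le_antisymm (sInf_le ⟨G₀, D₀, E₀, hG₀, hD₀, hE₀, rfl⟩) (htop ▸ le_top)
  obtain ⟨c, hc_anti, hclim, hcS⟩ := exists_seq_tendsto_sInf hne (OrderBot.bddBelow S)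
  obtain ⟨n₀, hn₀⟩ := (hclim.eventually_lt_const (lt_top_iff_ne_top.2 htop)).exists
  choose G D E hG hD hE hcE using hcS
  have hEP : ∀ n i, nlPer K (E (n + n₀) i) ≤ 2 * c n₀ := fun n i => by
    have h1 : 2⁻¹ * ∑ i, nlPer K (E (n + n₀) i) ≤ c n₀ :=
      le_add_self.trans ((hcE (n + n₀)).symm.le.trans (hc_anti (Nat.le_add_left _ _)))
    rw [ENNReal.inv_mul_le_iff (by simp) (by simp)] at h1
    exact (Finset.single_le_sum (f := fun i => nlPer K (E (n + n₀) i)) (fun _ _ => bot_le)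
      (Finset.mem_univ i)).trans h1
  let U : Ultrafilter ℕ := hyperfilter ℕ
  have hU : Tendsto (fun n => c (n + n₀)) U (𝓝 (sInf S)) :=
    ((tendsto_add_atTop_iff_nat n₀).2 hclim).mono_left Nat.hyperfilter_le_atTop
  obtain ⟨pD, hpD⟩ := exists_tendsto_ultrafilter U fun n => nlPer K (D (n + n₀))
  choose p hp using fun i => exists_tendsto_ultrafilter U fun n => nlPer K (E (n + n₀) i)
  obtain ⟨G', D', E', hG', hD', hE', hDle, hEle⟩ := exists_limit_of_nlPer_le hd hs.1 hC hK
    (P := 2 * c n₀) (by finiteness) (pow_pos hL d) hv hsum U (fun n => hG (n + n₀))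
    (fun n => hD (n + n₀)) (fun n => hE (n + n₀)) hEP hpD hp
  refine ⟨G', D', E', hG', hD', hE',
    le_antisymm (sInf_le ⟨G', D', E', hG', hD', hE', rfl⟩) ?_⟩
  have hlim : Tendsto (fun n => c (n + n₀)) U
      (𝓝 (ENNReal.ofReal μ * pD + 2⁻¹ * ∑ i, p i)) := by
    simp only [hcE]
    exact (ENNReal.Tendsto.const_mul hpD (Or.inr ENNReal.ofReal_ne_top)).add
      (ENNReal.Tendsto.const_mul (tendsto_finsetSum _ fun i _ => hp i) (Or.inr (by simp)))
  rw [tendsto_nhds_unique hU hlim]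
  gcongr with i
  exact hEle i

end
end

section
/- Let d ≥ 1, s ∈ (0,1), C > 0 and let K be a measurable kernel on ℝ^d with K(x) ≥ C·|x|^(−d−s) for all x ≠ 0. Let Ω ⊆ ℝ^d be a bounded open set and let (E_n) be Borel subsets of ℝ^d with sup_n Per_K(E_n, Ω) < ∞. Then there exist a subsequence (E_{n_k}) and a Borel set E ⊆ ℝ^d such that |((E_{n_k} ∩ Ω) Δ (E ∩ Ω))| → 0 as k → ∞, i.e. E_{n_k} ∩ Ω → E ∩ Ω in L^1. -/
open MeasureTheory Filter Topology
open scoped symmDiff ENNReal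

noncomputable section

variable {d : ℕ}

theorem exists_subseq_tendsto_symmDiff {α : Type*} [MeasurableSpace α] (μ : Measure α)
    [IsFiniteMeasure μ] (A : ℕ → Set α) (hA : ∀ n, MeasurableSet (A n))
    (hT : ∀ ε : ℝ≥0∞, 0 < ε → ∃ T : Set (Set α), T.Finite ∧ (∀ B ∈ T, MeasurableSet B) ∧
      ∀ n, ∃ B ∈ T, μ (A n ∆ B) < ε) :
    ∃ φ : ℕ → ℕ, StrictMono φ ∧ ∃ F : Set α, MeasurableSet F ∧
      Tendsto (fun k => μ (A (φ k) ∆ F)) atTop (𝓝 0) := by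
  let f : ℕ → Lp ℝ 1 μ := fun n => indicatorConstLp 1 (hA n) (measure_ne_top μ _) 1
  have htb : TotallyBounded (Set.range f) := by
    rw [EMetric.totallyBounded_iff]
    intro ε hε
    obtain ⟨T, hTf, hTm, hTA⟩ := hT ε hε
    have := hTf.to_subtype
    refine ⟨Set.range fun B : T =>
      indicatorConstLp (E := ℝ) 1 (hTm B B.2) (measure_ne_top μ _) 1, Set.finite_range _, ?_⟩
    rintro _ ⟨n, rfl⟩
    obtain ⟨B, hB, hlt⟩ := hTA n
    simp only [Set.mem_iUnion]
    refine ⟨_, ⟨⟨B, hB⟩, rfl⟩, ?_⟩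
    rw [Metric.mem_eball, edist_indicatorConstLp_eq_enorm]
    refine enorm_indicatorConstLp_le.trans_lt ?_
    simpa using hlt
  obtain ⟨g, -, φ, hφ, hlim⟩ := (htb.closure.isCompact_of_isClosed isClosed_closure).tendsto_subseq
    (x := f) fun n => subset_closure ⟨n, rfl⟩
  refine ⟨φ, hφ, {x | 1 / 2 ≤ g x}, measurableSet_le measurable_const
    (Lp.stronglyMeasurable g).measurable, ?_⟩
  have hbound : ∀ k, μ (A (φ k) ∆ {x | 1 / 2 ≤ g x}) ≤ 2 * edist (f (φ k)) g := by
    intro k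
    have h := meas_ge_le_mul_pow_eLpNorm_enorm (ε := 2⁻¹) μ one_ne_zero ENNReal.one_ne_top
      (Lp.aestronglyMeasurable (f (φ k) - g)) (by simp) (by simp)
    simp only [inv_inv, ENNReal.toReal_one, ENNReal.rpow_one] at h
    rw [← Lp.enorm_def, ← edist_eq_enorm_sub] at h
    refine le_trans (measure_mono_ae ?_) h
    filter_upwards [Lp.coeFn_sub (f (φ k)) g,
      indicatorConstLp_coeFn (p := 1) (hs := hA (φ k)) (hμs := measure_ne_top μ _) (c := (1 : ℝ))]
      with x hx1 hx2 hx
    have key : (1 / 2 : ℝ) ≤ |(f (φ k) - g : Lp ℝ 1 μ) x| := by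
      rw [hx1, Pi.sub_apply]
      replace hx : x ∈ A (φ k) ∆ {x | 1 / 2 ≤ g x} := hx
      simp only [f]
      rw [hx2]
      rcases hx with ⟨h1, h2⟩ | ⟨h1, h2⟩
      · simp only [Set.mem_ofPred_eq, not_le] at h2
        rw [Set.indicator_of_mem h1]
        exact le_trans (by linarith) (le_abs_self _)
      · simp only [Set.mem_ofPred_eq] at h1
        rw [Set.indicator_of_notMem h2, zero_sub, abs_neg]
        exact h1.trans (le_abs_self _)
    change (2⁻¹ : ℝ≥0∞) ≤ ‖(f (φ k) - g : Lp ℝ 1 μ) x‖ₑ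
    rw [Real.enorm_eq_ofReal_abs]
    refine le_trans (le_of_eq ?_) (ENNReal.ofReal_le_ofReal key)
    rw [one_div, ENNReal.ofReal_inv_of_pos two_pos]; simp
  have h0 : Tendsto (fun k => 2 * edist (f (φ k)) g) atTop (𝓝 0) := by
    have := ENNReal.Tendsto.const_mul (a := 2) (tendsto_iff_edist_tendsto_0.1 hlim) (by simp)
    simpa using this
  exact tendsto_of_tendsto_of_tendsto_of_le_of_le tendsto_const_nhds h0 (fun _ => zero_le) hbound

theorem min_mul_le_of_mul_le {a b m k J : ℝ≥0∞} (hm : m ≤ a + b) (h : a * b * k ≤ J) :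
    min a b * (m * k) ≤ 2 * J := by
  calc min a b * (m * k) ≤ min a b * ((2 * max a b) * k) := by
        gcongr
        calc m ≤ a + b := hm
          _ ≤ max a b + max a b := by gcongr <;> simp
          _ = _ := (two_mul _).symm
    _ = 2 * (min a b * max a b * k) := by ring
    _ = 2 * (a * b * k) := by rw [min_mul_max]
    _ ≤ _ := by gcongr

theorem measure_mul_measure_le_lintegral {K : Vd d → ℝ≥0∞} {k : ℝ≥0∞} {A B : Set (Vd d)}
    (hA : MeasurableSet A) (hB : MeasurableSet B) (h : ∀ x ∈ A, ∀ y ∈ B, k ≤ K (x - y)) :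
    volume A * volume B * k ≤ ∫⁻ x in A, ∫⁻ y in B, K (x - y) := by
  calc volume A * volume B * k = ∫⁻ _ in A, ∫⁻ _ in B, k := by
        simp only [lintegral_const, Measure.restrict_apply_univ]; ring
    _ ≤ _ := setLIntegral_mono' hA fun x hx => setLIntegral_mono' hB fun y hy => h x hx y hy

theorem exists_finset_approx {ι : Type*} {K : Vd d → ℝ≥0∞} {k m : ℝ≥0∞}
    {Ω E : Set (Vd d)} (hE : MeasurableSet E) (I : Finset ι) (Q : ι → Set (Vd d))
    (hQm : ∀ i ∈ I, MeasurableSet (Q i)) (hQΩ : ∀ i ∈ I, Q i ⊆ Ω)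
    (hdisj : (I : Set ι).PairwiseDisjoint Q) (hvol : ∀ i ∈ I, volume (Q i) = m)
    (hK : ∀ i ∈ I, ∀ x ∈ Q i, ∀ y ∈ Q i, x ≠ y → k ≤ K (x - y)) :
    ∃ S ⊆ I, volume ((E ∆ ⋃ i ∈ S, Q i) ∩ Ω) * (m * k) ≤
      volume (Ω \ ⋃ i ∈ I, Q i) * (m * k) + 2 * nlPerRel K E Ω := by
  classical
  let S := I.filter fun i => volume (Q i \ E) ≤ volume (E ∩ Q i)
  refine ⟨S, Finset.filter_subset _ _, ?_⟩
  let P : ι → Set (Vd d) := fun i => if i ∈ S then Q i \ E else E ∩ Q i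
  have hP : ∀ i ∈ I, volume (P i) = min (volume (E ∩ Q i)) (volume (Q i \ E)) := by
    intro i hi
    by_cases h : volume (Q i \ E) ≤ volume (E ∩ Q i)
    · have : i ∈ S := Finset.mem_filter.2 ⟨hi, h⟩
      simp only [P, if_pos this, min_eq_right h]
    · have : i ∉ S := fun hh => h (Finset.mem_filter.1 hh).2
      simp only [P, if_neg this, min_eq_left (le_of_not_ge h)]
  have hsub : (E ∆ ⋃ i ∈ S, Q i) ∩ Ω ⊆ (Ω \ ⋃ i ∈ I, Q i) ∪ ⋃ i ∈ I, P i := by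
    rintro x ⟨hx, hxΩ⟩
    by_cases hxI : x ∈ ⋃ i ∈ I, Q i
    · right
      rcases hx with ⟨hxE, hxS⟩ | ⟨hxS, hxE⟩
      · simp only [Set.mem_iUnion, exists_prop] at hxI hxS ⊢
        obtain ⟨i, hi, hxi⟩ := hxI
        refine ⟨i, hi, ?_⟩
        have : i ∉ S := fun h => hxS ⟨i, h, hxi⟩
        simp only [P, if_neg this]
        exact ⟨hxE, hxi⟩
      · simp only [Set.mem_iUnion, exists_prop] at hxS ⊢
        obtain ⟨i, hi, hxi⟩ := hxS
        refine ⟨i, (Finset.mem_filter.1 hi).1, ?_⟩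
        simp only [P, if_pos hi]
        exact ⟨hxi, hxE⟩
    · exact Or.inl ⟨hxΩ, hxI⟩
  have hsum : ∑ i ∈ I, ∫⁻ x in E ∩ Q i, ∫⁻ y in Q i \ E, K (x - y) ≤ nlPerRel K E Ω := by
    calc ∑ i ∈ I, ∫⁻ x in E ∩ Q i, ∫⁻ y in Q i \ E, K (x - y)
        ≤ ∑ i ∈ I, ∫⁻ x in E ∩ Q i, ∫⁻ y in Eᶜ, K (x - y) :=
          Finset.sum_le_sum fun i _ => lintegral_mono fun x =>
            lintegral_mono_set fun y hy => hy.2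
      _ = ∫⁻ x in ⋃ i ∈ I, E ∩ Q i, ∫⁻ y in Eᶜ, K (x - y) :=
          (lintegral_biUnion_finset
            (hdisj.mono fun i => Set.inter_subset_right) (fun i hi => hE.inter (hQm i hi)) _).symm
      _ ≤ ∫⁻ x in E ∩ Ω, ∫⁻ y in Eᶜ, K (x - y) :=
          lintegral_mono_set <| Set.iUnion₂_subset fun i hi =>
            Set.inter_subset_inter_right _ (hQΩ i hi)
      _ ≤ _ := le_self_add
  calc volume ((E ∆ ⋃ i ∈ S, Q i) ∩ Ω) * (m * k)
      ≤ (volume (Ω \ ⋃ i ∈ I, Q i) + ∑ i ∈ I, volume (P i)) * (m * k) := by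
        gcongr
        exact (measure_mono hsub).trans <| (measure_union_le _ _).trans <| by
          gcongr; exact measure_biUnion_finset_le _ _
    _ = volume (Ω \ ⋃ i ∈ I, Q i) * (m * k) + ∑ i ∈ I, volume (P i) * (m * k) := by
        rw [add_mul, Finset.sum_mul]
    _ ≤ volume (Ω \ ⋃ i ∈ I, Q i) * (m * k) +
        ∑ i ∈ I, 2 * ∫⁻ x in E ∩ Q i, ∫⁻ y in Q i \ E, K (x - y) := by
        refine add_le_add le_rfl (Finset.sum_le_sum fun i hi => ?_)
        rw [hP i hi]
        refine min_mul_le_of_mul_le ?_ (measure_mul_measure_le_lintegral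
          (hE.inter (hQm i hi)) ((hQm i hi).diff hE)
          fun x hx y hy => hK i hi x hx.2 y hy.1 fun h => hy.2 (h ▸ hx.1))
        rw [← hvol i hi, Set.inter_comm]
        exact (measure_inter_add_sdiff _ hE).ge
    _ ≤ _ := by
        rw [← Finset.mul_sum]
        gcongr

/-- The cell of index `ν` of the cubical grid of mesh `1 / n`. -/
def gridCell (n : ℕ) [NeZero n] (ν : Fin d → ℤ) : Set (Vd d) :=
  WithLp.ofLp ⁻¹' (BoxIntegral.unitPartition.box n ν : Set (Fin d → ℝ))

theorem measurableSet_gridCell (n : ℕ) [NeZero n] (ν : Fin d → ℤ) :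
    MeasurableSet (gridCell n ν) :=
  (PiLp.volume_preserving_ofLp (Fin d)).measurable (BoxIntegral.Box.measurableSet_coe _)

theorem volume_gridCell (n : ℕ) [NeZero n] (ν : Fin d → ℤ) :
    volume (gridCell n ν) = 1 / (n : ℝ≥0∞) ^ d := by
  rw [gridCell, (PiLp.volume_preserving_ofLp (Fin d)).measure_preimage
    (BoxIntegral.Box.measurableSet_coe _).nullMeasurableSet,
    BoxIntegral.unitPartition.volume_box, Fintype.card_fin]

theorem mem_gridCell_iff {n : ℕ} [NeZero n] {ν : Fin d → ℤ} {x : Vd d} :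
    x ∈ gridCell n ν ↔ BoxIntegral.unitPartition.index n (WithLp.ofLp x) = ν :=
  BoxIntegral.unitPartition.mem_box_iff_index

theorem pairwiseDisjoint_gridCell (n : ℕ) [NeZero n] (s : Set (Fin d → ℤ)) :
    s.PairwiseDisjoint (gridCell n) := by
  intro ν _ ν' _ hne
  refine Set.disjoint_left.2 fun x hx hx' => hne ?_
  rw [← mem_gridCell_iff.1 hx, mem_gridCell_iff.1 hx']

theorem dist_le_of_mem_gridCell {n : ℕ} [NeZero n] {ν : Fin d → ℤ} {x y : Vd d}
    (hx : x ∈ gridCell n ν) (hy : y ∈ gridCell n ν) : dist x y ≤ d / n := by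
  have hn : (0 : ℝ) < n := Nat.cast_pos.2 (NeZero.pos n)
  have h : ∀ i, dist (x i) (y i) ≤ 1 / n := by
    intro i
    have h1 := BoxIntegral.unitPartition.mem_box_iff.1 hx i
    have h2 := BoxIntegral.unitPartition.mem_box_iff.1 hy i
    rw [add_div] at h1 h2
    rw [Real.dist_eq, abs_le]
    constructor <;> linarith [h1.1, h1.2, h2.1, h2.2]
  rw [EuclideanSpace.dist_eq, Real.sqrt_le_iff]
  refine ⟨by positivity, ?_⟩
  calc ∑ i, dist (x i) (y i) ^ 2 ≤ ∑ _i : Fin d, (1 / (n : ℝ)) ^ 2 := by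
        gcongr with i; exact h i
    _ = d * (1 / (n : ℝ)) ^ 2 := by simp
    _ ≤ (d : ℝ) ^ 2 * (1 / (n : ℝ)) ^ 2 := by
        gcongr
        exact_mod_cast Nat.le_self_pow two_ne_zero d
    _ = _ := by ring

theorem finite_setOf_gridCell_subset (n : ℕ) [NeZero n] {Ω : Set (Vd d)}
    (hΩ : MeasurableSet Ω) (hvol : volume Ω ≠ ⊤) : {ν | gridCell n ν ⊆ Ω}.Finite := by
  have hmp := PiLp.volume_preserving_toLp (Fin d)
  refine (BoxIntegral.unitPartition.setFinite_index n
    (s := WithLp.toLp 2 ⁻¹' Ω) (hmp.measurable hΩ).nullMeasurableSet ?_).subset ?_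
  · rwa [hmp.measure_preimage hΩ.nullMeasurableSet]
  · intro ν hν x hx
    exact hν (show WithLp.toLp 2 x ∈ gridCell n ν from hx)

theorem diff_iUnion_gridCell_subset (n : ℕ) [NeZero n] (Ω : Set (Vd d)) :
    Ω \ ⋃ ν ∈ {ν | gridCell n ν ⊆ Ω}, gridCell n ν ⊆ Metric.cthickening (d / n) Ωᶜ := by
  rintro x ⟨-, hx⟩
  have hmem : x ∈ gridCell n (BoxIntegral.unitPartition.index n (WithLp.ofLp x)) :=
    mem_gridCell_iff.2 rfl
  have hns : ¬ gridCell n (BoxIntegral.unitPartition.index n (WithLp.ofLp x)) ⊆ Ω :=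
    fun h => hx (Set.mem_biUnion h hmem)
  obtain ⟨y, hy, hyΩ⟩ := Set.not_subset.1 hns
  exact Metric.mem_cthickening_of_dist_le x y _ _ hyΩ (dist_le_of_mem_gridCell hmem hy)

theorem tendsto_volume_diff_iUnion_gridCell {Ω : Set (Vd d)} (hΩ : IsOpen Ω)
    (hvol : volume Ω ≠ ⊤) :
    Tendsto (fun n : ℕ => volume (Ω \ ⋃ ν ∈ {ν | gridCell (n + 1) ν ⊆ Ω}, gridCell (n + 1) ν))
      atTop (𝓝 0) := by
  have : IsFiniteMeasure (volume.restrict Ω) := ⟨by simpa using hvol.lt_top⟩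
  have h1 := tendsto_measure_cthickening_of_isClosed (μ := volume.restrict Ω) (s := Ωᶜ)
    ⟨1, one_pos, measure_ne_top _ _⟩ hΩ.isClosed_compl
  rw [Measure.restrict_apply hΩ.measurableSet.compl, Set.compl_inter_self, measure_empty] at h1
  have h2 : Tendsto (fun n : ℕ => (d : ℝ) / ((n + 1 : ℕ) : ℝ)) atTop (𝓝 0) :=
    (tendsto_const_div_atTop_nhds_zero_nat (d : ℝ)).comp (tendsto_add_atTop_nat 1)
  refine tendsto_of_tendsto_of_tendsto_of_le_of_le tendsto_const_nhds (h1.comp h2)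
    (fun _ => zero_le) fun n => ?_
  rw [Function.comp_apply, Measure.restrict_apply Metric.isClosed_cthickening.measurableSet]
  exact measure_mono (Set.subset_inter (diff_iUnion_gridCell_subset _ _) Set.sdiff_subset)

theorem tendsto_cell_volume_mul_kernel (hd : 1 ≤ d) {s C : ℝ} (hs : 0 < s) (hC : 0 < C) :
    Tendsto (fun n : ℕ => 1 / ((n + 1 : ℕ) : ℝ≥0∞) ^ d *
      ENNReal.ofReal (C * ((d : ℝ) / ((n + 1 : ℕ) : ℝ)) ^ (-(d : ℝ) - s))) atTop (𝓝 ⊤) := by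
  have hd' : (0 : ℝ) < d := by exact_mod_cast hd
  have hreal : Tendsto (fun n : ℕ => C * (d : ℝ) ^ (-(d : ℝ) - s) * ((n + 1 : ℕ) : ℝ) ^ s)
      atTop atTop :=
    (((tendsto_rpow_atTop hs).comp tendsto_natCast_atTop_atTop).comp
      (tendsto_add_atTop_nat 1)).const_mul_atTop (by positivity)
  refine (ENNReal.tendsto_ofReal_atTop.comp hreal).congr fun n => ?_
  have hn : (0 : ℝ) < ((n + 1 : ℕ) : ℝ) := by positivity
  have h1 : (1 : ℝ≥0∞) / ((n + 1 : ℕ) : ℝ≥0∞) ^ d =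
      ENNReal.ofReal (((n + 1 : ℕ) : ℝ) ^ (-(d : ℝ))) := by
    rw [Real.rpow_neg hn.le, Real.rpow_natCast, ENNReal.ofReal_inv_of_pos (by positivity),
      ENNReal.ofReal_pow hn.le, ENNReal.ofReal_natCast, one_div]
  rw [h1, ← ENNReal.ofReal_mul (by positivity), Function.comp_apply]
  congr 1
  rw [Real.div_rpow hd'.le hn.le]
  have : ((n + 1 : ℕ) : ℝ) ^ s =
      ((n + 1 : ℕ) : ℝ) ^ (-(d : ℝ)) / ((n + 1 : ℕ) : ℝ) ^ (-(d : ℝ) - s) := by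
    rw [← Real.rpow_sub hn]; congr 1; ring
  rw [this]; ring

theorem stmt10 {d : ℕ} (hd : 1 ≤ d) (s C : ℝ) (hs : s ∈ Set.Ioo (0:ℝ) 1) (hC : 0 < C)
    (K : Vd d → ℝ≥0∞) (hmeas : Measurable K)
    (hlow : ∀ x : Vd d, x ≠ 0 → ENNReal.ofReal (C * ‖x‖ ^ (-(d : ℝ) - s)) ≤ K x)
    (Ω : Set (Vd d)) (hΩ : IsOpen Ω) (hbd : Bornology.IsBounded Ω)
    (E : ℕ → Set (Vd d)) (hE : ∀ n, MeasurableSet (E n))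
    (hsup : (⨆ n, nlPerRel K (E n) Ω) < ⊤) :
    ∃ φ : ℕ → ℕ, StrictMono φ ∧ ∃ F : Set (Vd d), MeasurableSet F ∧
      Tendsto (fun k => volume ((E (φ k) ∩ Ω) ∆ (F ∩ Ω))) atTop (𝓝 0) := by
  have hvol : volume Ω ≠ ⊤ := hbd.measure_lt_top.ne
  have : IsFiniteMeasure (volume.restrict Ω) := ⟨by simpa using hvol.lt_top⟩
  set M := ⨆ n, nlPerRel K (E n) Ω
  obtain ⟨φ, hφ, F, hF, hlim⟩ := exists_subseq_tendsto_symmDiff (volume.restrict Ω) E hE <| by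
    intro ε hε
    have hw := tendsto_volume_diff_iUnion_gridCell hΩ hvol
    have hc := tendsto_cell_volume_mul_kernel hd hs.1 hC
    have hq := ENNReal.Tendsto.const_div (a := 2 * M) hc (Or.inr (by finiteness))
    rw [ENNReal.div_top] at hq
    have hwq := hw.add hq
    rw [add_zero] at hwq
    obtain ⟨n, hn, hc0⟩ := ((hwq.eventually_lt_const hε).and
      (hc.eventually_const_lt ENNReal.zero_lt_top)).exists
    have hfin := finite_setOf_gridCell_subset (n + 1) hΩ.measurableSet hvol
    let I := hfin.toFinset
    refine ⟨(fun S : Finset (Fin d → ℤ) => ⋃ ν ∈ S, gridCell (n + 1) ν) '' I.powerset,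
      (Finset.finite_toSet _).image _, ?_, fun j => ?_⟩
    · rintro _ ⟨S, -, rfl⟩
      exact Finset.measurableSet_biUnion _ fun ν _ => measurableSet_gridCell _ _
    obtain ⟨S, hSI, hS⟩ := exists_finset_approx (K := K) (Ω := Ω)
      (k := ENNReal.ofReal (C * ((d : ℝ) / ((n + 1 : ℕ) : ℝ)) ^ (-(d : ℝ) - s)))
      (hE j) I (gridCell (n + 1)) (fun _ _ => measurableSet_gridCell _ _)
      (fun ν hν => hfin.mem_toFinset.1 hν) (pairwiseDisjoint_gridCell _ _)
      (fun _ _ => volume_gridCell _ _) (fun ν _ x hx y hy hxy => by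
        refine le_trans (ENNReal.ofReal_le_ofReal ?_) (hlow _ (sub_ne_zero.2 hxy))
        refine mul_le_mul_of_nonneg_left ?_ hC.le
        refine Real.rpow_le_rpow_of_nonpos (norm_pos_iff.2 (sub_ne_zero.2 hxy)) ?_ ?_
        · rw [← dist_eq_norm]
          exact dist_le_of_mem_gridCell hx hy
        · linarith [hs.1, (Nat.cast_nonneg d : (0 : ℝ) ≤ d)])
    refine ⟨_, ⟨S, Finset.mem_coe.2 (Finset.mem_powerset.2 hSI), rfl⟩, ?_⟩
    rw [Measure.restrict_apply ((hE j).symmDiff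
      (Finset.measurableSet_biUnion _ fun ν _ => measurableSet_gridCell _ _))]
    refine lt_of_le_of_lt ?_ hn
    have hc_top : 1 / ((n + 1 : ℕ) : ℝ≥0∞) ^ d *
        ENNReal.ofReal (C * ((d : ℝ) / ((n + 1 : ℕ) : ℝ)) ^ (-(d : ℝ) - s)) ≠ ⊤ :=
      ENNReal.mul_ne_top (ENNReal.div_ne_top ENNReal.one_ne_top (by simp)) ENNReal.ofReal_ne_top
    have hU : ⋃ ν ∈ I, gridCell (n + 1) ν =
        ⋃ ν ∈ {ν | gridCell (n + 1) ν ⊆ Ω}, gridCell (n + 1) ν := by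
      simp only [I, Set.Finite.mem_toFinset]
    rw [hU] at hS
    rw [← ENNReal.mul_le_mul_iff_left hc0.ne' hc_top, add_mul,
      ENNReal.div_mul_cancel hc0.ne' hc_top]
    refine hS.trans ?_
    gcongr
    exact le_iSup (fun n => nlPerRel K (E n) Ω) j
  refine ⟨φ, hφ, F, hF, hlim.congr fun k => ?_⟩
  rw [Measure.restrict_apply ((hE _).symmDiff hF)]
  congr 1
  ext x
  simp only [Set.mem_inter_iff, Set.mem_symmDiff]
  tauto

end
end
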